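/- arXiv:2412.01315 — 4 statements merged into one kernel-verified Lean document; each statement's English description precedes it below -/
import Mathlib

section
/- Let E be a countable Borel equivalence relation on the Ellentuck space [ℕ]^ℕ. Then there exists an infinite set A ⊆ ℕ such that the restriction of E to [A]^ℕ (the infinite subsets of A) is hyperfinite; explicitly, there is a Borel map f : [ℕ]^ℕ → 2^ℕ such that for all infinite B, C ⊆ A, B E C holds if and only if f(B) and f(C) are eventually equal. -/
/-- The Ellentuck space `[ℕ]^ℕ`: the infinite subsets of `ℕ`, as a subtype of
`Set ℕ ≃ 2^ℕ`, with the induced Borel σ-algebra. -/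
abbrev Ellentuck : Type := {A : Set ℕ // A.Infinite}

/-- Two elements of `2^ℕ` are eventually equal if they agree at all but finitely
many coordinates. -/
def EventuallyEqual (x y : ℕ → Bool) : Prop := ∀ᶠ n in Filter.atTop, x n = y n

/-- The list of the first `n` values of `x`. -/
def initSeg (x : ℕ → ℕ) (n : ℕ) : List ℕ := (List.range n).map x

@[simp] theorem initSeg_zero (x : ℕ → ℕ) : initSeg x 0 = [] := rfl

@[simp] theorem length_initSeg (x : ℕ → ℕ) (n : ℕ) : (initSeg x n).length = n := by
  simp [initSeg]

theorem initSeg_succ (x : ℕ → ℕ) (n : ℕ) : initSeg x (n + 1) = initSeg x n ++ [x n] := by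
  simp [initSeg, List.range_succ]

theorem take_initSeg (x : ℕ → ℕ) {j n : ℕ} (h : j ≤ n) :
    (initSeg x n).take j = initSeg x j := by
  rw [initSeg, ← List.map_take, List.take_range, min_eq_left h, initSeg]

theorem initSeg_eq_iff {x y : ℕ → ℕ} {n : ℕ} :
    initSeg x n = initSeg y n ↔ ∀ i < n, x i = y i := by
  simp [initSeg]

theorem initSeg_eq_of_le {x y : ℕ → ℕ} {j n : ℕ} (h : initSeg x n = initSeg y n) (hj : j ≤ n) :
    initSeg x j = initSeg y j := by
  rw [initSeg_eq_iff] at h ⊢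
  exact fun i hi => h i (hi.trans_le hj)

/-- `W` attaches to every finite sequence a set of allowed next values; it is large if all these
sets belong to a fixed nonprincipal ultrafilter. -/
def IsLarge (W : List ℕ → Set ℕ) : Prop := ∀ r, W r ∈ Filter.hyperfilter ℕ

/-- From position `n` on, the values of `x` are allowed by `W`. -/
def Follows (W : List ℕ → Set ℕ) (n : ℕ) (x : ℕ → ℕ) : Prop :=
  ∀ m ≥ n, x m ∈ W (initSeg x m)

theorem Follows.mono {W W' : List ℕ → Set ℕ} {n : ℕ} {x : ℕ → ℕ} (h : Follows W n x)
    (hW : ∀ r, W r ⊆ W' r) : Follows W' n x :=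
  fun m hm => hW _ (h m hm)

theorem IsLarge.inter {W W' : List ℕ → Set ℕ} (h : IsLarge W) (h' : IsLarge W') :
    IsLarge fun r => W r ∩ W' r :=
  fun r => Filter.inter_mem (h r) (h' r)

theorem isLarge_univ : IsLarge fun _ => Set.univ := fun _ => Filter.univ_mem

theorem isLarge_biInter {ι : Type*} {s : Set ι} (hs : s.Finite) {V : ι → List ℕ → Set ℕ}
    (hV : ∀ i, IsLarge (V i)) : IsLarge fun r => ⋂ i ∈ s, V i r :=
  fun r => (Filter.biInter_mem hs).2 fun i _ => hV i r

theorem exists_isLarge_fusion {V : List ℕ → List ℕ → Set ℕ} (hV : ∀ t, IsLarge (V t)) :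
    ∃ W, IsLarge W ∧
      ∀ x n, Follows W n x → ∀ j ≥ n, Follows (V (initSeg x j)) j x := by
  refine ⟨fun r => ⋂ j ∈ Set.Iic r.length, V (r.take j) r,
    fun r => (Filter.biInter_mem (Set.finite_Iic _)).2 fun j _ => hV _ r, ?_⟩
  intro x n hx j hj m hm
  have h := hx m (hj.trans hm)
  simp only [length_initSeg, Set.mem_iInter] at h
  have := h j hm
  rwa [take_initSeg x hm] at this

theorem exists_isLarge_hit_or_avoid (G : Set (List ℕ)) (s : List ℕ) :
    (∃ W, IsLarge W ∧ ∀ x, initSeg x s.length = s → Follows W s.length x →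
      ∃ n > s.length, initSeg x n ∈ G) ∨
    (∃ W, IsLarge W ∧ ∀ x, initSeg x s.length = s → Follows W s.length x →
      ∀ n > s.length, initSeg x n ∉ G) := by
  classical
  set good : List ℕ → Prop := fun t => ∃ W, IsLarge W ∧
    ∀ x, initSeg x t.length = t → Follows W t.length x →
      ∃ n > t.length, initSeg x n ∈ G with hgood
  have key : ∀ t, ¬ good t →
      {n | t ++ [n] ∉ G ∧ ¬ good (t ++ [n])} ∈ Filter.hyperfilter ℕ := by
    intro t ht
    by_contra hcon
    refine ht ?_
    rw [← Ultrafilter.compl_mem_iff_notMem] at hcon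
    have : ∀ r, ∃ V, IsLarge V ∧ (good r → ∀ x, initSeg x r.length = r →
        Follows V r.length x → ∃ n > r.length, initSeg x n ∈ G) := by
      intro r
      by_cases hr : good r
      · obtain ⟨V, hV, h⟩ := hr
        exact ⟨V, hV, fun _ => h⟩
      · exact ⟨_, isLarge_univ, fun h => (hr h).elim⟩
    choose V hVl hV using this
    obtain ⟨W, hWl, hW⟩ := exists_isLarge_fusion hVl
    refine ⟨fun r => W r ∩ if r = t then {n | t ++ [n] ∉ G ∧ ¬ good (t ++ [n])}ᶜ else Set.univ,
      hWl.inter fun r => ?_, fun x hxt hx => ?_⟩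
    · by_cases hr : r = t
      · simpa [hr] using hcon
      · simp only [if_neg hr]
        exact Filter.univ_mem
    · have h0 := (hx _ le_rfl).2
      rw [if_pos hxt] at h0
      have hsucc : initSeg x (t.length + 1) = t ++ [x t.length] := by rw [initSeg_succ, hxt]
      by_cases hG : t ++ [x t.length] ∈ G
      · exact ⟨t.length + 1, Nat.lt_succ_self _, hsucc ▸ hG⟩
      · have hg : good (initSeg x (t.length + 1)) := by
          by_contra hng
          exact h0 ⟨hG, hsucc ▸ hng⟩
        have hf := hW x t.length (hx.mono fun r => Set.inter_subset_left) (t.length + 1)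
          (Nat.le_succ _)
        obtain ⟨n, hn, hnG⟩ := hV _ hg x (by simp) (by simpa using hf)
        rw [length_initSeg] at hn
        exact ⟨n, by omega, hnG⟩
  by_cases hs : good s
  · exact Or.inl hs
  right
  refine ⟨fun t => if good t then Set.univ else {n | t ++ [n] ∉ G ∧ ¬ good (t ++ [n])},
    fun t => ?_, fun x hxs hx => ?_⟩
  · by_cases ht : good t
    · simp only [if_pos ht]
      exact Filter.univ_mem
    · simpa [ht] using key t ht
  · have hng : ∀ n ≥ s.length, ¬ good (initSeg x n) := by
      intro n hn
      induction n, hn using Nat.le_induction with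
      | base => rwa [hxs]
      | succ n hn ih =>
        have := hx n hn
        simp only [if_neg ih] at this
        rw [initSeg_succ]
        exact this.2
    intro n hn
    obtain ⟨n, rfl⟩ : ∃ k, n = k + 1 := ⟨n - 1, by omega⟩
    have := hx n (by omega)
    simp only [if_neg (hng n (by omega))] at this
    rw [initSeg_succ]
    exact this.1

/-- The image under `g` of the sequences extending `v`. -/
def cylinderImage (g : (ℕ → ℕ) → ℕ → ℕ) (v : List ℕ) : Set (ℕ → ℕ) :=
  g '' {z | initSeg z v.length = v}

theorem exists_mem_cylinderImage_append {g : (ℕ → ℕ) → ℕ → ℕ} {v : List ℕ} {x : ℕ → ℕ}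
    (h : x ∈ cylinderImage g v) : ∃ k, x ∈ cylinderImage g (v ++ [k]) := by
  obtain ⟨z, hz, rfl⟩ := h
  refine ⟨z v.length, z, ?_, rfl⟩
  simp only [Set.mem_ofPred_eq] at hz
  simp [initSeg_succ, hz]

/-- Some large `W` keeps the sequences extending `s` out of the set `S`. -/
def IsAvoidable (S : Set (ℕ → ℕ)) (s : List ℕ) : Prop :=
  ∃ W, IsLarge W ∧ ∀ x, initSeg x s.length = s → Follows W s.length x → x ∉ S

theorem exists_isLarge_of_not_isAvoidable {g : (ℕ → ℕ) → ℕ → ℕ} {s u : List ℕ}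
    (h : ¬ IsAvoidable (cylinderImage g u) s) :
    ∃ W, IsLarge W ∧ ∀ x, initSeg x s.length = s → Follows W s.length x →
      ∃ n > s.length, ∃ k, Encodable.encode (u ++ [k]) ≤ n ∧
        ¬ IsAvoidable (cylinderImage g (u ++ [k])) (initSeg x n) := by
  rcases exists_isLarge_hit_or_avoid {t | ∃ k, Encodable.encode (u ++ [k]) ≤ t.length ∧
    ¬ IsAvoidable (cylinderImage g (u ++ [k])) t} s with ⟨W, hWl, hW⟩ | ⟨W, hWl, hW⟩
  · refine ⟨W, hWl, fun x hxs hx => ?_⟩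
    obtain ⟨n, hn, k, hk⟩ := hW x hxs hx
    exact ⟨n, hn, k, by simpa using hk⟩
  · refine (h ?_).elim
    have : ∀ (v t : List ℕ), ∃ V, IsLarge V ∧ (IsAvoidable (cylinderImage g v) t →
        ∀ x, initSeg x t.length = t → Follows V t.length x → x ∉ cylinderImage g v) := by
      intro v t
      by_cases ht : IsAvoidable (cylinderImage g v) t
      · obtain ⟨V, hV, h⟩ := ht
        exact ⟨V, hV, fun _ => h⟩
      · exact ⟨_, isLarge_univ, fun h => (ht h).elim⟩
    choose V hVl hV using this
    obtain ⟨W', hW'l, hW'⟩ := exists_isLarge_fusion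
      (V := fun t r => ⋂ i ∈ Set.Iic t.length, V (Denumerable.ofNat (List ℕ) i) t r)
      fun t => isLarge_biInter (Set.finite_Iic _) fun i => hVl _ _
    refine ⟨_, hWl.inter hW'l, fun x hxs hx hxu => ?_⟩
    obtain ⟨k, hk⟩ := exists_mem_cylinderImage_append hxu
    set j := max (s.length + 1) (Encodable.encode (u ++ [k])) with hj
    have hjs : s.length < j := by omega
    have hav : IsAvoidable (cylinderImage g (u ++ [k])) (initSeg x j) := by
      by_contra hna
      exact hW x hxs (hx.mono fun r => Set.inter_subset_left) j hjs
        ⟨k, by simp [hj], hna⟩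
    have hf := hW' x s.length (hx.mono fun r => Set.inter_subset_right) j hjs.le
    refine hV _ _ hav x (by simp) ?_ hk
    rw [length_initSeg]
    refine hf.mono fun r => ?_
    refine (Set.biInter_subset_of_mem (x := Encodable.encode (u ++ [k])) ?_).trans ?_
    · simp [hj]
    · simp

theorem eq_of_forall_exists_cylinderImage {g : (ℕ → ℕ) → ℕ → ℕ} (hg : Continuous g)
    {x z : ℕ → ℕ}
    (h : ∀ i, ∃ y ∈ cylinderImage g (initSeg z i), initSeg y i = initSeg x i) : g z = x := by
  funext m
  have hopen : IsOpen {y | g y m = g z m} :=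
    (isOpen_discrete {g z m}).preimage ((continuous_apply m).comp hg)
  obtain ⟨N, hN⟩ : ∃ N, PiNat.cylinder z N ⊆ {y | g y m = g z m} := by
    obtain ⟨_, ⟨w, N, rfl⟩, hz, hsub⟩ :=
      (PiNat.isTopologicalBasis_cylinders fun _ : ℕ => ℕ).exists_subset_of_mem_open
        (show z ∈ {y | g y m = g z m} from rfl) hopen
    exact ⟨N, by rwa [PiNat.mem_cylinder_iff_eq.1 hz]⟩
  obtain ⟨_, ⟨y, hy, rfl⟩, hyx⟩ := h (max N (m + 1))
  simp only [length_initSeg, Set.mem_ofPred_eq] at hy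
  rw [initSeg_eq_iff] at hy hyx
  have h1 : g y m = g z m := hN fun i hi => hy i (lt_max_of_lt_left hi)
  rw [← h1]
  exact hyx m (by simp)

theorem exists_isLarge_of_analyticSet {S : Set (ℕ → ℕ)} (hS : MeasureTheory.AnalyticSet S) :
    ∃ W, IsLarge W ∧ ((∀ x, Follows W 0 x → x ∈ S) ∨ ∀ x, Follows W 0 x → x ∉ S) := by
  rw [MeasureTheory.AnalyticSet] at hS
  obtain rfl | ⟨g, hg, rfl⟩ := hS
  · exact ⟨_, isLarge_univ, Or.inr fun x _ => Set.notMem_empty x⟩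
  by_cases h : IsAvoidable (cylinderImage g []) []
  · obtain ⟨W, hWl, hW⟩ := h
    exact ⟨W, hWl, Or.inr fun x hx => by simpa [cylinderImage] using hW x rfl hx⟩
  have : ∀ (u t : List ℕ), ∃ V, IsLarge V ∧ (¬ IsAvoidable (cylinderImage g u) t →
      ∀ x, initSeg x t.length = t → Follows V t.length x →
      ∃ n > t.length, ∃ k, Encodable.encode (u ++ [k]) ≤ n ∧
        ¬ IsAvoidable (cylinderImage g (u ++ [k])) (initSeg x n)) := by
    intro u t
    by_cases ht : IsAvoidable (cylinderImage g u) t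
    · exact ⟨_, isLarge_univ, fun h => (h ht).elim⟩
    · obtain ⟨V, hV, h⟩ := exists_isLarge_of_not_isAvoidable ht
      exact ⟨V, hV, fun _ => h⟩
  choose V hVl hV using this
  obtain ⟨W, hWl, hW⟩ := exists_isLarge_fusion
    (V := fun t r => ⋂ i ∈ Set.Iic t.length, V (Denumerable.ofNat (List ℕ) i) t r)
    fun t => isLarge_biInter (Set.finite_Iic _) fun i => hVl _ _
  refine ⟨W, hWl, Or.inl fun x hx => ?_⟩
  set P : ℕ × List ℕ → Prop := fun p => Encodable.encode p.2 ≤ p.1 ∧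
    ¬ IsAvoidable (cylinderImage g p.2) (initSeg x p.1) with hP
  have step : ∀ p : {p // P p}, ∃ q : {p // P p}, p.1.1 < q.1.1 ∧ ∃ k, q.1.2 = p.1.2 ++ [k] := by
    rintro ⟨⟨n, u⟩, hu, hna⟩
    have hf := hW x 0 hx n (Nat.zero_le _)
    obtain ⟨n', hn', k, hk, hna'⟩ := hV u (initSeg x n) hna x (by simp) (by
      rw [length_initSeg]
      refine hf.mono fun r => (Set.biInter_subset_of_mem (x := Encodable.encode u) ?_).trans ?_
      · simpa using hu
      · simp)
    exact ⟨⟨(n', u ++ [k]), hk, hna'⟩, by simpa using hn', k, rfl⟩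
  choose next hlt z' hz' using step
  let p : ℕ → {p // P p} := fun i => Nat.rec ⟨(0, []), by simp, h⟩
    (fun _ q => next q) i
  have hp : ∀ i, p (i + 1) = next (p i) := fun _ => rfl
  set z : ℕ → ℕ := fun i => z' (p i) with hz
  have hzp : ∀ i, (p i).1.2 = initSeg z i := by
    intro i
    induction i with
    | zero => rfl
    | succ i ih => rw [hp, hz', ih, initSeg_succ]
  have hle : ∀ i, i ≤ (p i).1.1 := by
    intro i
    induction i with
    | zero => exact Nat.zero_le _
    | succ i ih => rw [hp]; exact Nat.succ_le_of_lt (ih.trans_lt (hlt _))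
  refine ⟨z, eq_of_forall_exists_cylinderImage hg fun i => ?_⟩
  have hna := (p i).2.2
  rw [hzp] at hna
  by_contra hcon
  refine hna ⟨_, isLarge_univ, fun y hy _ hmem => hcon ⟨y, hmem, ?_⟩⟩
  rw [length_initSeg] at hy
  exact initSeg_eq_of_le hy (hle i)

theorem exists_strictMono_follows {W : List ℕ → Set ℕ} (hW : IsLarge W) :
    ∃ m : ℕ → ℕ, StrictMono m ∧ ∀ φ : ℕ → ℕ, StrictMono φ → Follows W 0 (m ∘ φ) := by
  classical
  have step : ∀ p : Finset (List ℕ) × ℕ, ∃ n > p.2, ∀ r ∈ p.1, n ∈ W r := by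
    rintro ⟨F, l⟩
    have h1 : (⋂ r ∈ (F : Set (List ℕ)), W r) ∩ Set.Ioi l ∈ Filter.hyperfilter ℕ :=
      Filter.inter_mem ((Filter.biInter_mem F.finite_toSet).2 fun r _ => hW r)
        (Filter.mem_hyperfilter_of_finite_compl (by simp [Set.finite_Iic]))
    obtain ⟨n, hn, hl⟩ := (Filter.hyperfilter ℕ).nonempty_of_mem h1
    exact ⟨n, hl, by simpa using hn⟩
  choose next hgt hmem using step
  let p : ℕ → Finset (List ℕ) × ℕ := fun i => Nat.rec ({[]}, 0)
    (fun _ q => (q.1 ∪ q.1.image (· ++ [next q]), next q)) i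
  have hp1 : ∀ i, (p (i + 1)).1 = (p i).1 ∪ (p i).1.image (· ++ [next (p i)]) := fun _ => rfl
  have hp2 : ∀ i, (p (i + 1)).2 = next (p i) := fun _ => rfl
  have hmono : Monotone fun i => (p i).1 :=
    monotone_nat_of_le_succ fun i => by rw [hp1]; exact Finset.subset_union_left
  refine ⟨fun i => next (p i), strictMono_nat_of_lt_succ fun i => ?_, fun φ hφ => ?_⟩
  · have := hgt (p (i + 1))
    rwa [hp2] at this
  · have hseg : ∀ n i, (∀ k < n, φ k < i) →
        initSeg ((fun i => next (p i)) ∘ φ) n ∈ (p i).1 := by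
      intro n
      induction n with
      | zero => exact fun i _ => hmono (Nat.zero_le i) (by simp [p])
      | succ n ih =>
        intro i hi
        refine hmono (Nat.succ_le_of_lt (hi n (Nat.lt_succ_self n))) ?_
        show _ ∈ (p (φ n + 1)).1
        rw [hp1, initSeg_succ, Finset.mem_union]
        exact Or.inr (Finset.mem_image.2 ⟨_, ih _ fun k hk => hφ hk, rfl⟩)
    exact fun n _ => hmem _ _ (hseg n _ fun k hk => hφ hk)

theorem exists_strictMono_range_comp_eq {m : ℕ → ℕ} {X : Set ℕ}
    (hX : X.Infinite) (hXm : X ⊆ Set.range m) :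
    ∃ φ : ℕ → ℕ, StrictMono φ ∧ Set.range (m ∘ φ) = X := by
  have hinf : {i | m i ∈ X}.Infinite := by
    refine Set.Infinite.of_image m ?_
    rwa [show m '' {i | m i ∈ X} = X from Set.image_preimage_eq_of_subset hXm]
  refine ⟨Nat.nth fun i => m i ∈ X, Nat.nth_strictMono hinf, ?_⟩
  rw [Set.range_comp, Nat.range_nth_of_infinite hinf]
  exact Set.image_preimage_eq_of_subset hXm

theorem initSeg_add (x : ℕ → ℕ) (j n : ℕ) :
    initSeg (fun i => x (j + i)) n = (initSeg x (j + n)).drop j := by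
  simp [initSeg, List.range_add, Function.comp_def]

theorem exists_strictMono_homogeneous {S₀ : Set (ℕ → ℕ)}
    (hS₀ : MeasureTheory.AnalyticSet S₀) {S : Finset ℕ → Finset ℕ → Set (ℕ → ℕ)}
    (hS : ∀ s t, MeasureTheory.AnalyticSet (S s t)) :
    ∃ m : ℕ → ℕ, StrictMono m ∧
      ((∀ φ : ℕ → ℕ, StrictMono φ → m ∘ φ ∈ S₀) ∨
        ∀ φ : ℕ → ℕ, StrictMono φ → m ∘ φ ∉ S₀) ∧
      ∀ K : ℕ, ∀ s ⊆ (Finset.range K).image m, ∀ t ⊆ (Finset.range K).image m,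
        (∀ φ : ℕ → ℕ, StrictMono φ → K ≤ φ 0 → m ∘ φ ∈ S s t) ∨
          ∀ φ : ℕ → ℕ, StrictMono φ → K ≤ φ 0 → m ∘ φ ∉ S s t := by
  obtain ⟨W₀, hW₀l, hW₀⟩ := exists_isLarge_of_analyticSet hS₀
  choose V hVl hV using fun s t => exists_isLarge_of_analyticSet (hS s t)
  obtain ⟨W, hWl, hW⟩ := exists_isLarge_fusion
    (V := fun l r => ⋂ p ∈ (l.toFinset.powerset ×ˢ l.toFinset.powerset : Finset _),
      V p.1 p.2 (r.drop l.length))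
    fun l r => (Filter.biInter_mem (Finset.finite_toSet _)).2 fun p _ => hVl _ _ _
  obtain ⟨m, hm, hmW⟩ := exists_strictMono_follows (hW₀l.inter hWl)
  refine ⟨m, hm, hW₀.imp ?_ ?_, fun K s hs t ht => ?_⟩
  · exact fun h φ hφ => h _ ((hmW φ hφ).mono fun r => Set.inter_subset_left)
  · exact fun h φ hφ => h _ ((hmW φ hφ).mono fun r => Set.inter_subset_left)
  · have key : ∀ φ : ℕ → ℕ, StrictMono φ → K ≤ φ 0 → Follows (V s t) 0 (m ∘ φ) := by
      intro φ hφ hK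
      set ψ : ℕ → ℕ := fun i => if i < K then i else φ (i - K) with hψ
      have hψmono : StrictMono ψ := by
        refine strictMono_nat_of_lt_succ fun i => ?_
        simp only [hψ]
        split_ifs with h1 h2 h2
        · exact Nat.lt_succ_self i
        · exact h1.trans_le (hK.trans (hφ.monotone (Nat.zero_le _)))
        · omega
        · exact hφ (by omega)
      have hshift : ∀ i, (m ∘ ψ) (K + i) = (m ∘ φ) i := by simp [hψ]
      have hf := hW _ 0 ((hmW ψ hψmono).mono fun r => Set.inter_subset_right) K (Nat.zero_le K)
      have hseg : (initSeg (m ∘ ψ) K).toFinset = (Finset.range K).image m := by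
        ext a
        simp only [initSeg, List.mem_toFinset, List.mem_map, List.mem_range, Finset.mem_image,
          Finset.mem_range]
        refine exists_congr fun i => and_congr_right fun hi => ?_
        simp [hψ, hi]
      intro n _
      have h := hf (K + n) (Nat.le_add_right _ _)
      simp only [hseg, length_initSeg, Set.mem_iInter] at h
      have h' := h (s, t) (Finset.mem_product.2
        ⟨Finset.mem_powerset.2 hs, Finset.mem_powerset.2 ht⟩)
      rw [← initSeg_add] at h'
      simp only [hshift] at h'
      exact h'
    exact (hV s t).imp (fun h φ hφ hK => h _ (key φ hφ hK)) fun h φ hφ hK => h _ (key φ hφ hK)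

/-- `C` is related to the set `B` of values of `x` at multiples of `3`, and infinitely many of its
elements lie outside `B`, all of them, up to those below `x 0`, between values of `x` at
consecutive positions congruent to `1` and `2` modulo `3`. -/
def IsInterleaved (E : Set ℕ → Set ℕ → Prop) (x : ℕ → ℕ) (C : Set ℕ) : Prop :=
  E (Set.range fun i => x (3 * i)) C ∧
    (∀ N, ∃ c > N, c ∈ C ∧ c ∉ Set.range fun i => x (3 * i)) ∧
    ∀ c ∈ C, c ∉ (Set.range fun i => x (3 * i)) →
      c < x 0 ∨ ∃ i, x (3 * i + 1) ≤ c ∧ c ≤ x (3 * i + 2)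

theorem measurable_range_comp (k : ℕ → ℕ) :
    Measurable fun x : ℕ → ℕ => Set.range fun i => x (k i) := by
  refine measurable_set_iff.2 fun a => ?_
  simp only [Set.mem_range]
  exact Measurable.exists fun i => measurableSet_setOfPred.1
    (measurableSet_eq_fun (measurable_pi_apply _) measurable_const)

theorem analyticSet_exists_isInterleaved {E : Set ℕ → Set ℕ → Prop}
    (hE : MeasurableSet {p : Set ℕ × Set ℕ | E p.1 p.2}) :
    MeasureTheory.AnalyticSet {x | ∃ C, IsInterleaved E x C} := by
  have hC : Measurable fun p : (ℕ → ℕ) × (ℕ → Prop) => {n | p.2 n} :=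
    measurable_set_iff.2 fun a => (measurable_pi_apply a).comp measurable_snd
  have hB : Measurable fun p : (ℕ → ℕ) × (ℕ → Prop) => Set.range fun i => p.1 (3 * i) :=
    (measurable_range_comp _).comp measurable_fst
  have hx : ∀ i, Measurable fun p : (ℕ → ℕ) × (ℕ → Prop) => p.1 i :=
    fun i => (measurable_pi_apply i).comp measurable_fst
  have hmem : ∀ a, Measurable fun p : (ℕ → ℕ) × (ℕ → Prop) => a ∈ {n | p.2 n} :=
    measurable_set_iff.1 hC
  have hmem' : ∀ a, Measurable fun p : (ℕ → ℕ) × (ℕ → Prop) =>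
      a ∉ Set.range fun i => p.1 (3 * i) := fun a => (measurable_set_iff.1 hB a).not
  have hM : MeasurableSet {p : (ℕ → ℕ) × (ℕ → Prop) | IsInterleaved E p.1 {n | p.2 n}} := by
    refine measurableSet_setOfPred.2 (Measurable.and ?_ (Measurable.and ?_ ?_))
    · exact measurableSet_setOfPred.1 (hE.preimage (hB.prodMk hC))
    · exact Measurable.forall fun N => Measurable.exists fun c =>
        measurable_const.and ((hmem c).and (hmem' c))
    · refine Measurable.forall fun c => (hmem c).imp ((hmem' c).imp (Measurable.or ?_ ?_))
      · exact measurableSet_setOfPred.1 (measurableSet_lt measurable_const (hx 0))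
      · exact Measurable.exists fun i =>
          (measurableSet_setOfPred.1 (measurableSet_le (hx _) measurable_const)).and
            (measurableSet_setOfPred.1 (measurableSet_le measurable_const (hx _)))
  convert hM.analyticSet_image measurable_fst using 1
  ext x
  constructor
  · rintro ⟨C, hC⟩
    exact ⟨(x, fun n => n ∈ C), hC, rfl⟩
  · rintro ⟨⟨x, c⟩, hp, rfl⟩
    exact ⟨_, hp⟩

theorem not_forall_exists_isInterleaved {E : Set ℕ → Set ℕ → Prop}
    (hE : ∀ B, {C | E B C}.Countable) {m : ℕ → ℕ} (hm : StrictMono m) :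
    ¬ ∀ φ : ℕ → ℕ, StrictMono φ → ∃ C, IsInterleaved E (m ∘ φ) C := by
  intro h
  let φ : (ℕ → Bool) → ℕ → ℕ := fun e n =>
    5 * (n / 3) + if n % 3 = 0 then 0 else n % 3 + if e (n / 3) then 2 else 0
  have hφ : ∀ e, StrictMono (φ e) := by
    refine fun e => strictMono_nat_of_lt_succ fun n => ?_
    obtain ⟨q, r, hr, rfl⟩ : ∃ q r, r < 3 ∧ n = 3 * q + r :=
      ⟨n / 3, n % 3, Nat.mod_lt _ (by norm_num), by omega⟩
    have h1 : (3 * q + r) / 3 = q := by omega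
    have h2 : (3 * q + r) % 3 = r := by omega
    interval_cases r
    · have h3 : (3 * q + 0 + 1) / 3 = q := by omega
      have h4 : (3 * q + 0 + 1) % 3 = 1 := by omega
      simp only [φ, h1, h2, h3, h4, ↓reduceIte, one_ne_zero]
      split_ifs <;> omega
    · have h3 : (3 * q + 1 + 1) / 3 = q := by omega
      have h4 : (3 * q + 1 + 1) % 3 = 2 := by omega
      simp only [φ, h1, h2, h3, h4, ↓reduceIte, one_ne_zero, two_ne_zero]
      split_ifs <;> omega
    · have h3 : (3 * q + 2 + 1) / 3 = q + 1 := by omega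
      have h4 : (3 * q + 2 + 1) % 3 = 0 := by omega
      simp only [φ, h1, h2, h3, h4, ↓reduceIte, two_ne_zero]
      split_ifs <;> omega
  have hφ0 : ∀ e i, φ e (3 * i) = 5 * i := by
    intro e i
    simp [φ]
  have hφ1 : ∀ e i, φ e (3 * i + 1) = 5 * i + 1 + if e i then 2 else 0 := by
    intro e i
    have h3 : (3 * i + 1) / 3 = i := by omega
    have h4 : (3 * i + 1) % 3 = 1 := by omega
    simp only [φ, h3, h4, ↓reduceIte, one_ne_zero]
    split_ifs <;> omega
  have hφ2 : ∀ e i, φ e (3 * i + 2) = 5 * i + 2 + if e i then 2 else 0 := by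
    intro e i
    have h3 : (3 * i + 2) / 3 = i := by omega
    have h4 : (3 * i + 2) % 3 = 2 := by omega
    simp only [φ, h3, h4, ↓reduceIte, two_ne_zero]
    split_ifs <;> omega
  set B : Set ℕ := Set.range fun i => m (5 * i) with hB
  have hBe : ∀ e, (Set.range fun i => (m ∘ φ e) (3 * i)) = B := by
    intro e
    simp only [Function.comp, hφ0, hB]
  choose C hC using fun e => h (φ e) (hφ e)
  have hCB : ∀ e, C e ∈ {D | E B D} := fun e => hBe e ▸ (hC e).1
  obtain ⟨D, hD⟩ := (hE B).exists_eq_range ⟨_, hCB fun _ => false⟩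
  -- `hits j i b`: the `j`-th set meets the interval that the choice `b` allows at `i`
  let hits : ℕ → ℕ → Bool → Prop := fun j i b => ∃ c ∈ D j, c ∉ B ∧
    m (5 * i + 1 + if b then 2 else 0) ≤ c ∧ c ≤ m (5 * i + 2 + if b then 2 else 0)
  obtain ⟨ι, hι, hιhits⟩ := Filter.extraction_forall_of_frequently
    (P := fun j i => (∃ᶠ i in Filter.atTop, ∃ b, hits j i b) → ∃ b, hits j i b) (by
      intro j
      by_cases hj : ∃ᶠ i in Filter.atTop, ∃ b, hits j i b
      · exact hj.mono fun i hi _ => hi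
      · exact (Filter.Eventually.of_forall fun i h => (hj h).elim).frequently)
  have : ∀ j, ∃ b, (∃ b, hits j (ι j) b) → hits j (ι j) (!b) := by
    intro j
    by_cases hj : ∃ b, hits j (ι j) b
    · obtain ⟨b, hb⟩ := hj
      exact ⟨!b, fun _ => by simpa using hb⟩
    · exact ⟨true, fun h => (hj h).elim⟩
  choose b hb using this
  obtain ⟨e, he⟩ : ∃ e : ℕ → Bool, ∀ j, e (ι j) = b j :=
    ⟨Function.extend ι b fun _ => false, hι.injective.extend_apply _ _⟩
  obtain ⟨j, hj⟩ : C e ∈ Set.range D := hD ▸ hCB e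
  obtain ⟨-, hinf, hint⟩ := hC e
  rw [hBe, ← hj] at hinf hint
  simp only [Function.comp, hφ1, hφ2] at hint
  have h0 : φ e 0 = 0 := hφ0 e 0
  have hfreq : ∃ᶠ i in Filter.atTop, ∃ b, hits j i b := by
    refine Filter.frequently_atTop.2 fun N => ?_
    obtain ⟨c, hcN, hcD, hcB⟩ := hinf (m (5 * N))
    obtain hc0 | ⟨i, hi1, hi2⟩ := hint c hcD hcB
    · rw [h0] at hc0
      have := hm.monotone (Nat.zero_le (5 * N))
      omega
    · refine ⟨i, ?_, e i, c, hcD, hcB, hi1, hi2⟩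
      have := hm.lt_iff_lt.1 (hcN.trans_le hi2)
      split_ifs at this <;> omega
  obtain ⟨c, hcD, hcB, h1, h2⟩ := hb j (hιhits j hfreq)
  rw [← he j] at h1 h2
  obtain hc0 | ⟨i, hi1, hi2⟩ := hint c hcD hcB
  · rw [h0] at hc0
    have := hm.monotone (Nat.zero_le (5 * ι j + 1 + if (!e (ι j)) = true then 2 else 0))
    omega
  · have h3 := hm.le_iff_le.1 (h1.trans hi2)
    have h4 := hm.le_iff_le.1 (hi1.trans h2)
    have hij : i = ι j := by split_ifs at h3 h4 <;> omega
    subst hij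
    cases hei : e (ι j) <;> simp [hei] at h3 h4

theorem eventually_mem_of_not_isInterleaved {E : Set ℕ → Set ℕ → Prop} {m : ℕ → ℕ}
    (hm : StrictMono m)
    (h : ∀ φ : ℕ → ℕ, StrictMono φ → ¬ ∃ C, IsInterleaved E (m ∘ φ) C) {B C : Set ℕ}
    (hBinf : B.Infinite) (hB : B ⊆ Set.range fun i => m (3 * i + 1))
    (hC : C ⊆ Set.range fun i => m (3 * i + 1)) (hBC : E B C) :
    ∃ N, ∀ c > N, c ∈ C → c ∈ B := by
  have hm' : StrictMono fun i => m (3 * i + 1) := hm.comp fun i j hij => by simpa using hij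
  obtain ⟨β, hβ, rfl⟩ := exists_strictMono_range_comp_eq hBinf hB
  by_contra! hcon
  let φ : ℕ → ℕ := fun n => if n % 3 = 0 then 3 * β (n / 3) + 1
    else if n % 3 = 1 then 3 * β (n / 3) + 2 else 3 * β (n / 3 + 1)
  have hφ0 : ∀ i, φ (3 * i) = 3 * β i + 1 := by
    intro i
    simp [φ]
  have hφ1 : ∀ i, φ (3 * i + 1) = 3 * β i + 2 := by
    intro i
    have h3 : (3 * i + 1) / 3 = i := by omega
    have h4 : (3 * i + 1) % 3 = 1 := by omega
    simp [φ, h3, h4]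
  have hφ2 : ∀ i, φ (3 * i + 2) = 3 * β (i + 1) := by
    intro i
    have h3 : (3 * i + 2) / 3 = i := by omega
    have h4 : (3 * i + 2) % 3 = 2 := by omega
    simp [φ, h3, h4]
  have hφ : StrictMono φ := by
    refine strictMono_nat_of_lt_succ fun n => ?_
    obtain ⟨q, r, hr, rfl⟩ : ∃ q r, r < 3 ∧ n = 3 * q + r :=
      ⟨n / 3, n % 3, Nat.mod_lt _ (by norm_num), by omega⟩
    have hlt := hβ (Nat.lt_succ_self q)
    rw [Nat.succ_eq_add_one] at hlt
    interval_cases r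
    · rw [add_zero, hφ0, hφ1]
      omega
    · rw [hφ1, hφ2]
      omega
    · rw [hφ2, show 3 * q + 2 + 1 = 3 * (q + 1) by ring, hφ0]
      omega
  have hrange : (Set.range fun i => (m ∘ φ) (3 * i)) = Set.range ((fun i => m (3 * i + 1)) ∘ β) := by
    simp only [Function.comp_def, hφ0]
  refine h φ hφ ⟨C, hrange ▸ hBC, hrange ▸ hcon, ?_⟩
  rw [hrange]
  intro c hc hcB
  obtain ⟨γ, rfl⟩ := hC hc
  have hne : ∀ i, β i ≠ γ := fun i hi => hcB ⟨i, by simp [hi]⟩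
  have hloc : ∀ i, γ < β i → γ < β 0 ∨ ∃ i, β i < γ ∧ γ < β (i + 1) := by
    intro i
    induction i with
    | zero => exact Or.inl
    | succ i ih =>
      intro hi
      rcases lt_or_gt_of_ne (hne i) with hlt | hgt
      · exact Or.inr ⟨i, hlt, hi⟩
      · exact ih hgt
  have hφ00 := hφ0 0
  rw [mul_zero] at hφ00
  simp only [Function.comp, hφ1, hφ2, hφ00, hm.lt_iff_lt, hm.le_iff_le]
  rcases hloc (γ + 1) (Nat.lt_of_lt_of_le (Nat.lt_succ_self _) hβ.le_apply) with h0 | ⟨i, h1, h2⟩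
  · exact Or.inl (by omega)
  · exact Or.inr ⟨i, by omega, by omega⟩

/-- The relation on all sets of naturals induced by a relation on the infinite ones. -/
def extendRel (E : Ellentuck → Ellentuck → Prop) (B C : Set ℕ) : Prop :=
  ∃ (hB : B.Infinite) (hC : C.Infinite), E ⟨B, hB⟩ ⟨C, hC⟩

theorem measurableSet_setOf_infinite : MeasurableSet {B : Set ℕ | B.Infinite} := by
  have h : {B : Set ℕ | B.Infinite} = {B | ∀ N, ∃ n ≥ N, n ∈ B} := by
    ext B
    have := Nat.frequently_atTop_iff_infinite (p := (· ∈ B))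
    rw [Filter.frequently_atTop] at this
    exact this.symm
  rw [h]
  exact measurableSet_setOfPred.2 (Measurable.forall fun N => Measurable.exists fun n =>
    measurable_const.and (measurable_set_iff.1 measurable_id n))

theorem measurableSet_extendRel {E : Ellentuck → Ellentuck → Prop}
    (hE : MeasurableSet {p : Ellentuck × Ellentuck | E p.1 p.2}) :
    MeasurableSet {p : Set ℕ × Set ℕ | extendRel E p.1 p.2} := by
  have hval : MeasurableEmbedding (Subtype.val : Ellentuck → Set ℕ) :=
    MeasurableEmbedding.subtype_coe measurableSet_setOf_infinite
  convert (hval.prodMap hval).measurableSet_image.2 hE using 1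
  ext ⟨B, C⟩
  constructor
  · rintro ⟨hB, hC, h⟩
    exact ⟨(⟨B, hB⟩, ⟨C, hC⟩), h, rfl⟩
  · rintro ⟨⟨B', C'⟩, h, heq⟩
    obtain ⟨rfl, rfl⟩ := Prod.mk.inj heq
    exact ⟨B'.2, C'.2, h⟩

theorem countable_extendRel {E : Ellentuck → Ellentuck → Prop}
    (hE : ∀ x : Ellentuck, {y : Ellentuck | E x y}.Countable) (B : Set ℕ) :
    {C | extendRel E B C}.Countable := by
  by_cases hB : B.Infinite
  · refine ((hE ⟨B, hB⟩).image Subtype.val).mono ?_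
    rintro C ⟨_, hC, h⟩
    exact ⟨⟨C, hC⟩, h, rfl⟩
  · refine Set.countable_empty.mono ?_
    rintro C ⟨hB', _, _⟩
    exact hB hB'

theorem analyticSet_extendRel_union {E : Ellentuck → Ellentuck → Prop}
    (hE : MeasurableSet {p : Ellentuck × Ellentuck | E p.1 p.2}) (s t : Finset ℕ) :
    MeasureTheory.AnalyticSet
      {x : ℕ → ℕ | extendRel E (↑s ∪ Set.range x) (↑t ∪ Set.range x)} := by
  have hu : ∀ s : Finset ℕ, Measurable fun x : ℕ → ℕ => (↑s ∪ Set.range x : Set ℕ) := fun s =>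
    measurable_set_iff.2 fun a =>
      measurable_const.or (measurable_set_iff.1 (measurable_range_comp id) a)
  exact ((measurableSet_extendRel hE).preimage ((hu s).prodMk (hu t))).analyticSet

theorem exists_infinite_canonical {E : Ellentuck → Ellentuck → Prop} (hEquiv : Equivalence E)
    (hE : MeasurableSet {p : Ellentuck × Ellentuck | E p.1 p.2})
    (hc : ∀ x : Ellentuck, {y : Ellentuck | E x y}.Countable) :
    ∃ A : Set ℕ, A.Infinite ∧
      (∀ B ⊆ A, ∀ C ⊆ A, extendRel E B C → ∃ N, ∀ a ≥ N, a ∈ B ↔ a ∈ C) ∧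
      ∀ n, ∀ s t : Finset ℕ, (∀ a ∈ s, a ∈ A ∧ a < n) → (∀ a ∈ t, a ∈ A ∧ a < n) →
        ∀ X ⊆ A, X.Infinite → (∀ a ∈ X, n ≤ a) → extendRel E (↑s ∪ X) (↑t ∪ X) →
        ∀ Y ⊆ A, Y.Infinite → (∀ a ∈ Y, n ≤ a) → extendRel E (↑s ∪ Y) (↑t ∪ Y) := by
  obtain ⟨m, hm, h0, h1⟩ := exists_strictMono_homogeneous
    (analyticSet_exists_isInterleaved (measurableSet_extendRel hE))
    (analyticSet_extendRel_union hE)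
  replace h0 := h0.resolve_left (not_forall_exists_isInterleaved (countable_extendRel hc) hm)
  have hm' : StrictMono fun i => m (3 * i + 1) := hm.comp fun i j hij => by simpa using hij
  have hAm : (Set.range fun i => m (3 * i + 1)) ⊆ Set.range m := by
    rintro _ ⟨i, rfl⟩
    exact ⟨_, rfl⟩
  refine ⟨Set.range fun i => m (3 * i + 1), Set.infinite_range_of_injective hm'.injective,
    fun B hB C hC hBC => ?_, fun n s t hs ht X hX hXi hXn hXE Y hY hYi hYn => ?_⟩
  · obtain ⟨hBi, hCi, h⟩ := hBC
    obtain ⟨N, hN⟩ := eventually_mem_of_not_isInterleaved hm h0 hBi hB hC ⟨hBi, hCi, h⟩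
    obtain ⟨N', hN'⟩ := eventually_mem_of_not_isInterleaved hm h0 hCi hC hB
      ⟨hCi, hBi, hEquiv.symm h⟩
    exact ⟨N + N' + 1, fun a ha => ⟨hN' a (by omega), hN a (by omega)⟩⟩
  · have hex : ∃ K, n ≤ m K := ⟨n, hm.le_apply⟩
    set K := Nat.find hex with hK
    have hlt : ∀ i, i < K ↔ m i < n := fun i =>
      ⟨fun hi => not_le.1 (Nat.find_min hex hi),
        fun hi => hm.lt_iff_lt.1 (hi.trans_le (Nat.find_spec hex))⟩
    have hsub : ∀ u : Finset ℕ, (∀ a ∈ u, a ∈ (Set.range fun i => m (3 * i + 1)) ∧ a < n) →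
        u ⊆ (Finset.range K).image m := by
      intro u hu a ha
      obtain ⟨haA, han⟩ := hu a ha
      obtain ⟨i, rfl⟩ := hAm haA
      exact Finset.mem_image_of_mem m (Finset.mem_range.2 ((hlt i).2 han))
    have henum : ∀ Z ⊆ (Set.range fun i => m (3 * i + 1)), Z.Infinite → (∀ a ∈ Z, n ≤ a) →
        ∃ φ : ℕ → ℕ, StrictMono φ ∧ K ≤ φ 0 ∧ Set.range (m ∘ φ) = Z := by
      intro Z hZ hZi hZn
      obtain ⟨φ, hφ, rfl⟩ := exists_strictMono_range_comp_eq hZi (hZ.trans hAm)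
      refine ⟨φ, hφ, not_lt.1 fun hlt0 => ?_, rfl⟩
      exact absurd ((hlt _).1 hlt0) (not_lt.2 (hZn _ ⟨0, rfl⟩))
    obtain ⟨φ, hφ, hφK, rfl⟩ := henum X hX hXi hXn
    obtain ⟨ψ, hψ, hψK, rfl⟩ := henum Y hY hYi hYn
    rcases h1 K s (hsub s hs) t (hsub t ht) with h | h
    · exact h ψ hψ hψK
    · exact (h φ hφ hφK hXE).elim

theorem eventually_decide_comp_eq_iff {ι : Type*} (e : ℕ ≃ ι) (P Q : ι → Prop)
    [DecidablePred P] [DecidablePred Q] :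
    EventuallyEqual (fun k => decide (P (e k))) (fun k => decide (Q (e k))) ↔
      {i | ¬ (P i ↔ Q i)}.Finite := by
  rw [EventuallyEqual, ← Nat.cofinite_eq_atTop, Filter.eventually_cofinite]
  simp only [decide_eq_decide]
  exact ⟨fun h => Set.Finite.of_preimage h e.surjective, fun h => h.preimage e.injective.injOn⟩

open Classical in
/-- The elements of `B` below `n`. -/
noncomputable def cut (B : Set ℕ) (n : ℕ) : Finset ℕ := (Finset.range n).filter (· ∈ B)

theorem mem_cut {B : Set ℕ} {n a : ℕ} : a ∈ cut B n ↔ a < n ∧ a ∈ B := by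
  simp [cut]

theorem cut_union_inter_Ici (B : Set ℕ) (n : ℕ) : ↑(cut B n) ∪ (B ∩ Set.Ici n) = B := by
  ext a
  simp only [Set.mem_union, Finset.mem_coe, mem_cut, Set.mem_inter_iff, Set.mem_Ici]
  have := lt_or_ge a n
  tauto

theorem infinite_inter_Ici {B : Set ℕ} (hB : B.Infinite) (n : ℕ) : (B ∩ Set.Ici n).Infinite :=
  fun h => hB (((cut B n).finite_toSet.union h).subset (cut_union_inter_Ici B n).ge)

theorem measurable_cut_comp (n : ℕ) (Q : Finset ℕ → Prop) :
    Measurable fun B : Ellentuck => Q (cut B.1 n) := by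
  have h : (fun B : Ellentuck => Q (cut B.1 n)) =
      fun B => ∃ u : Finset ℕ, Q u ∧ ∀ a, (a < n ∧ a ∈ B.1) ↔ a ∈ u := by
    funext B
    refine propext ⟨fun h => ⟨_, h, fun a => mem_cut.symm⟩, ?_⟩
    rintro ⟨u, hu, h⟩
    rwa [show cut B.1 n = u from Finset.ext fun a => mem_cut.trans (h a)]
  rw [h]
  exact Measurable.exists fun u => measurable_const.and (Measurable.forall fun a =>
    (measurable_const.and (measurable_set_iff.1 measurable_subtype_coe a)).iff measurable_const)

/-- Adding any infinite subset of `A` without elements below `n` to `s` and to `t` produces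
equivalent sets. -/
def EquivBeyond (E : Ellentuck → Ellentuck → Prop) (A : Set ℕ) (n : ℕ) (s t : Finset ℕ) : Prop :=
  ∀ X ⊆ A, X.Infinite → (∀ a ∈ X, n ≤ a) → extendRel E (↑s ∪ X) (↑t ∪ X)

/-- The binary invariants of `B`: its elements and, for every `n`, the finite sets below `n`
equivalent beyond `n` to the part of `B` below `n`. -/
def Invariant (E : Ellentuck → Ellentuck → Prop) (A B : Set ℕ) : ℕ ⊕ ℕ × Finset ℕ → Prop
  | Sum.inl n => n ∈ B
  | Sum.inr (n, t) => t ⊆ Finset.range n ∧ EquivBeyond E A n t (cut B n)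

theorem EquivBeyond.symm {E : Ellentuck → Ellentuck → Prop} (hEquiv : Equivalence E) {A : Set ℕ}
    {n : ℕ} {s t : Finset ℕ} (h : EquivBeyond E A n s t) : EquivBeyond E A n t s := by
  intro X hX hXi hXn
  obtain ⟨hs, ht, h⟩ := h X hX hXi hXn
  exact ⟨ht, hs, hEquiv.symm h⟩

theorem EquivBeyond.trans {E : Ellentuck → Ellentuck → Prop} (hEquiv : Equivalence E) {A : Set ℕ}
    {n : ℕ} {s t u : Finset ℕ} (h : EquivBeyond E A n s t) (h' : EquivBeyond E A n t u) :
    EquivBeyond E A n s u := by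
  intro X hX hXi hXn
  obtain ⟨hs, _, h⟩ := h X hX hXi hXn
  obtain ⟨_, hu, h'⟩ := h' X hX hXi hXn
  exact ⟨hs, hu, hEquiv.trans h h'⟩

theorem EquivBeyond.refl {E : Ellentuck → Ellentuck → Prop} (hEquiv : Equivalence E) (A : Set ℕ)
    (n : ℕ) (s : Finset ℕ) : EquivBeyond E A n s s :=
  fun _ _ hXi _ => ⟨hXi.mono Set.subset_union_right, hXi.mono Set.subset_union_right,
    hEquiv.refl _⟩

theorem finite_invariant_ne_of_rel {E : Ellentuck → Ellentuck → Prop} (hEquiv : Equivalence E)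
    {A : Set ℕ}
    (htail : ∀ B ⊆ A, ∀ C ⊆ A, extendRel E B C → ∃ N, ∀ a ≥ N, a ∈ B ↔ a ∈ C)
    (hcanon : ∀ n, ∀ s t : Finset ℕ, (∀ a ∈ s, a ∈ A ∧ a < n) → (∀ a ∈ t, a ∈ A ∧ a < n) →
        ∀ X ⊆ A, X.Infinite → (∀ a ∈ X, n ≤ a) → extendRel E (↑s ∪ X) (↑t ∪ X) →
        EquivBeyond E A n s t)
    {B C : Ellentuck} (hB : B.1 ⊆ A) (hC : C.1 ⊆ A) (h : E B C) :
    {i | ¬ (Invariant E A B.1 i ↔ Invariant E A C.1 i)}.Finite := by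
  obtain ⟨N, hN⟩ := htail B.1 hB C.1 hC ⟨B.2, C.2, h⟩
  have hcut : ∀ n ≥ N, EquivBeyond E A n (cut B.1 n) (cut C.1 n) := by
    intro n hn
    have htl : B.1 ∩ Set.Ici n = C.1 ∩ Set.Ici n := by
      ext a
      exact and_congr_left fun ha => hN a (hn.trans ha)
    refine hcanon n _ _ (fun a ha => ?_) (fun a ha => ?_) (B.1 ∩ Set.Ici n)
      (Set.inter_subset_left.trans hB) (infinite_inter_Ici B.2 n) (fun a ha => ha.2) ?_
    · exact ⟨hB (mem_cut.1 ha).2, (mem_cut.1 ha).1⟩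
    · exact ⟨hC (mem_cut.1 ha).2, (mem_cut.1 ha).1⟩
    · rw [cut_union_inter_Ici, htl, cut_union_inter_Ici]
      exact ⟨B.2, C.2, h⟩
  refine (((Set.finite_Iio N).image Sum.inl).union (((Set.finite_Iio N).prod
    (Finset.finite_toSet (Finset.range N).powerset)).image Sum.inr)).subset ?_
  rintro (n | ⟨n, t⟩) hi
  · refine Or.inl ⟨n, ?_, rfl⟩
    by_contra hn
    exact hi (hN n (not_lt.1 hn))
  · have hn : n < N := by
      by_contra hn
      refine hi (and_congr_right fun _ => ?_)
      have := hcut n (not_lt.1 hn)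
      exact ⟨fun h => h.trans hEquiv this, fun h => h.trans hEquiv (this.symm hEquiv)⟩
    refine Or.inr ⟨(n, t), ⟨hn, ?_⟩, rfl⟩
    have ht : t ⊆ Finset.range n := by
      by_contra ht
      exact hi ⟨fun h => (ht h.1).elim, fun h => (ht h.1).elim⟩
    exact Finset.mem_coe.2 (Finset.mem_powerset.2 (ht.trans (Finset.range_mono hn.le)))

theorem rel_of_finite_invariant_ne {E : Ellentuck → Ellentuck → Prop} (hEquiv : Equivalence E)
    {A : Set ℕ} {B C : Ellentuck} (hB : B.1 ⊆ A)
    (h : {i | ¬ (Invariant E A B.1 i ↔ Invariant E A C.1 i)}.Finite) : E B C := by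
  obtain ⟨N, hN⟩ := (h.image (Sum.elim id Prod.fst)).bddAbove
  have hinv : ∀ i, N < Sum.elim id Prod.fst i → (Invariant E A B.1 i ↔ Invariant E A C.1 i) := by
    intro i hi
    by_contra hne
    exact absurd (hN ⟨i, hne, rfl⟩) (not_le.2 hi)
  have htl : B.1 ∩ Set.Ici (N + 1) = C.1 ∩ Set.Ici (N + 1) := by
    ext a
    exact and_congr_left fun ha => hinv (Sum.inl a) ha
  have hEB : EquivBeyond E A (N + 1) (cut B.1 (N + 1)) (cut C.1 (N + 1)) :=
    ((hinv (Sum.inr (N + 1, cut B.1 (N + 1))) (Nat.lt_succ_self N)).1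
      ⟨fun a ha => Finset.mem_range.2 (mem_cut.1 ha).1, EquivBeyond.refl hEquiv _ _ _⟩).2
  have := hEB (B.1 ∩ Set.Ici (N + 1)) (Set.inter_subset_left.trans hB)
    (infinite_inter_Ici B.2 _) fun a ha => ha.2
  rw [cut_union_inter_Ici, htl, cut_union_inter_Ici] at this
  exact this.2.2

theorem measurable_invariant (E : Ellentuck → Ellentuck → Prop) (A : Set ℕ)
    (i : ℕ ⊕ ℕ × Finset ℕ) : Measurable fun B : Ellentuck => Invariant E A B.1 i := by
  rcases i with n | ⟨n, t⟩
  · exact measurable_set_iff.1 measurable_subtype_coe n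
  · exact measurable_const.and (measurable_cut_comp n _)

/-- Every countable Borel equivalence relation on the Ellentuck space is hyperfinite
on some cube `[A]^ℕ`. -/
theorem cber_hyperfinite_on_cube
    (E : Ellentuck → Ellentuck → Prop)
    (hEquiv : Equivalence E)
    (hEBorel : MeasurableSet {p : Ellentuck × Ellentuck | E p.1 p.2})
    (hEctble : ∀ x : Ellentuck, {y : Ellentuck | E x y}.Countable) :
    ∃ A : Set ℕ, A.Infinite ∧
      ∃ f : Ellentuck → (ℕ → Bool), Measurable f ∧
        ∀ B C : Ellentuck, B.1 ⊆ A → C.1 ⊆ A →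
          (E B C ↔ EventuallyEqual (f B) (f C)) := by
  classical
  obtain ⟨A, hA, htail, hcanon⟩ := exists_infinite_canonical hEquiv hEBorel hEctble
  let e : ℕ ≃ ℕ ⊕ ℕ × Finset ℕ := (Denumerable.eqv _).symm
  refine ⟨A, hA, fun B k => decide (Invariant E A B.1 (e k)), ?_, fun B C hB hC => ?_⟩
  · refine measurable_pi_iff.2 fun k => ?_
    exact (measurable_of_countable fun p : Prop => decide p).comp (measurable_invariant E A (e k))
  · rw [eventually_decide_comp_eq_iff e (Invariant E A B.1) (Invariant E A C.1)]
    exact ⟨finite_invariant_ne_of_rel hEquiv htail hcanon hB hC,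
      rel_of_finite_invariant_ne hEquiv hB⟩
end

section
/- Let E be a countable Borel equivalence relation on a Polish space X, let (Gₙ)ₙ be an increasing (Gₙ ⊆ Gₙ₊₁) sequence of bounded-degree Borel graphs on X whose union is E minus the diagonal (i.e., ⋃ₙ Gₙ = {(x,y) ∈ E : x ≠ y}), and let f : ℕ → ℕ satisfy f(n+1) ≥ max(f(n)+2, 2·(f(n)+1)) for all n. Assume Bₙ ⊆ X are Borel sets such that each Bₙ is f(n)-separated in Gₙ. Then the restriction of E to B = {x : x ∈ Bₙ for infinitely many n} is hyperfinite; explicitly, there is a Borel map g : X → 2^ℕ such that for all x, y ∈ B, x E y iff g(x) and g(y) are eventually equal. -/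
/-- A graph (symmetric irreflexive relation) has bounded degree if there is `d` such
that every vertex has at most `d` neighbors. -/
def BddDegreeGraph {X : Type*} (G : SimpleGraph X) : Prop :=
  ∃ d : ℕ, ∀ x : X, {y | G.Adj x y}.Finite ∧ {y | G.Adj x y}.ncard ≤ d

/-- A Borel graph: the adjacency relation is Borel as a subset of `X × X`. -/
def BorelGraph {X : Type*} [MeasurableSpace X] (G : SimpleGraph X) : Prop :=
  MeasurableSet {p : X × X | G.Adj p.1 p.2}

/-- `B` is `k`-separated in `G` if any two distinct points of `B` have graph
distance `> k` (in particular points in different components are separated). -/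
def SeparatedIn {X : Type*} (G : SimpleGraph X) (k : ℕ) (B : Set X) : Prop :=
  ∀ x ∈ B, ∀ y ∈ B, x ≠ y → (k : ℕ∞) < G.edist x y

open Set
universe u

/-- Every section `{y | (x, y) ∈ P}` lies in a finset with at most `d` elements. -/
def SectionsCardLE {X Y : Type*} (d : ℕ) (P : Set (X × Y)) : Prop :=
  ∀ x, ∃ F : Finset Y, F.card ≤ d ∧ ∀ y, (x, y) ∈ P → y ∈ F

theorem measurableSet_image_fst_of_label {X Y : Type*} [MeasurableSpace X] [StandardBorelSpace X]
    [MeasurableSpace Y] [StandardBorelSpace Y] {P : Set (X × Y)} (hP : MeasurableSet P)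
    {l : X × Y → ℕ} (hl : Measurable l)
    (hinj : ∀ p ∈ P, ∀ q ∈ P, p.1 = q.1 → l p = l q → p = q) :
    MeasurableSet (Prod.fst '' P) := by
  have h : Prod.fst '' P = ⋃ i, Prod.fst '' (P ∩ l ⁻¹' {i}) := by
    ext x
    simp
  rw [h]
  refine MeasurableSet.iUnion fun i => ?_
  refine (hP.inter (hl (measurableSet_singleton i))).image_of_measurable_injOn measurable_fst ?_
  rintro p ⟨hp, hpi⟩ q ⟨hq, hqi⟩ hpq
  exact hinj p hp q hq hpq (hpi.trans hqi.symm)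

/-- A Borel set with uniformly bounded sections is a countable union of Borel partial functions. -/
theorem SectionsCardLE.exists_label {Y : Type u} [MeasurableSpace Y] [StandardBorelSpace Y]
    (d : ℕ) : ∀ {X : Type u} [MeasurableSpace X] [StandardBorelSpace X] {P : Set (X × Y)},
    MeasurableSet P → SectionsCardLE d P →
    ∃ l : X × Y → ℕ, Measurable l ∧
      ∀ p ∈ P, ∀ q ∈ P, p.1 = q.1 → l p = l q → p = q := by
  obtain ⟨φ, hφ⟩ := MeasureTheory.exists_measurableEmbedding_real Y
  induction d with
  | zero =>
    intro X _ _ P _ hd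
    refine ⟨fun _ => 0, measurable_const, fun p hp => ?_⟩
    obtain ⟨F, hF, hm⟩ := hd p.1
    have := hm p.2 hp
    simp_all
  | succ d ih =>
    intro X _ _ P hP hd
    classical
    let Q : Set ((X × Y) × Y) := {q | q.1 ∈ P ∧ (q.1.1, q.2) ∈ P ∧ φ q.2 < φ q.1.2}
    have hQ : MeasurableSet Q := by
      have h1 : MeasurableSet {q : (X × Y) × Y | q.1 ∈ P} := measurable_fst hP
      have h2 : MeasurableSet {q : (X × Y) × Y | (q.1.1, q.2) ∈ P} :=
        (by fun_prop : Measurable fun q : (X × Y) × Y => (q.1.1, q.2)) hP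
      have h3 : MeasurableSet {q : (X × Y) × Y | φ q.2 < φ q.1.2} :=
        measurableSet_lt (hφ.measurable.comp measurable_snd)
          (hφ.measurable.comp (measurable_snd.comp measurable_fst))
      exact h1.inter (h2.inter h3)
    have hQd : SectionsCardLE d Q := by
      rintro ⟨x, y⟩
      obtain ⟨F, hF, hm⟩ := hd x
      by_cases hy : y ∈ F
      · refine ⟨F.erase y, by rw [Finset.card_erase_of_mem hy]; omega, ?_⟩
        rintro z ⟨-, hz, hlt⟩
        exact Finset.mem_erase.2 ⟨fun h => by simp [h] at hlt, hm z hz⟩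
      · exact ⟨∅, by simp, fun z hz => absurd (hm y hz.1) hy⟩
    obtain ⟨l', hl', hinj'⟩ := ih hQ hQd
    have hM : MeasurableSet (Prod.fst '' Q) := measurableSet_image_fst_of_label hQ hl' hinj'
    have hMd : SectionsCardLE d (Prod.fst '' Q) := by
      intro x
      obtain ⟨F, hF, hm⟩ := hd x
      rcases (F.filter fun y => (x, y) ∈ P).eq_empty_or_nonempty with h0 | hne
      · refine ⟨∅, by simp, ?_⟩
        rintro y ⟨q, hq, hqy⟩
        have hp : (x, y) ∈ P := hqy ▸ hq.1
        have : y ∈ F.filter fun y => (x, y) ∈ P := Finset.mem_filter.2 ⟨hm y hp, hp⟩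
        simp [h0] at this
      · obtain ⟨y₀, hy₀, hmin⟩ := Finset.exists_min_image _ φ hne
        rw [Finset.mem_filter] at hy₀
        refine ⟨F.erase y₀, by rw [Finset.card_erase_of_mem hy₀.1]; omega, ?_⟩
        rintro y ⟨⟨p, z⟩, ⟨hp, hz, hlt⟩, rfl : p = (x, y)⟩
        refine Finset.mem_erase.2 ⟨?_, hm y hp⟩
        rintro rfl
        exact absurd hlt (not_lt.2 (hmin z (Finset.mem_filter.2 ⟨hm z hz, hz⟩)))
    obtain ⟨l, hl, hinj⟩ := ih hM hMd
    refine ⟨fun p => if p ∈ Prod.fst '' Q then l p + 1 else 0,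
      Measurable.ite hM (by fun_prop) measurable_const, ?_⟩
    intro p hp q hq hpq hlpq
    by_cases hpM : p ∈ Prod.fst '' Q <;> by_cases hqM : q ∈ Prod.fst '' Q
    · simp only [hpM, hqM, if_true] at hlpq
      exact hinj p hpM q hqM hpq (by omega)
    · simp [hpM, hqM] at hlpq
    · simp [hpM, hqM] at hlpq
    · obtain ⟨x, y⟩ := p
      obtain ⟨x', y'⟩ := q
      obtain rfl : x = x' := hpq
      rcases lt_trichotomy (φ y) (φ y') with h | h | h
      · exact absurd ⟨((x, y'), y), ⟨hq, hp, h⟩, rfl⟩ hqM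
      · rw [hφ.injective h]
      · exact absurd ⟨((x, y), y'), ⟨hp, hq, h⟩, rfl⟩ hpM

theorem SectionsCardLE.measurableSet_image_fst {X Y : Type u} [MeasurableSpace X]
    [StandardBorelSpace X] [MeasurableSpace Y] [StandardBorelSpace Y] {d : ℕ} {P : Set (X × Y)}
    (hd : SectionsCardLE d P) (hP : MeasurableSet P) : MeasurableSet (Prod.fst '' P) := by
  obtain ⟨l, hl, hinj⟩ := SectionsCardLE.exists_label d hP hd
  exact measurableSet_image_fst_of_label hP hl hinj

theorem eventuallyEqual_comp_equiv_iff {T : Type*} (e : ℕ ≃ T) (a b : T → Bool) :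
    EventuallyEqual (a ∘ e) (b ∘ e) ↔ {t | a t ≠ b t}.Finite := by
  rw [EventuallyEqual, ← Nat.cofinite_eq_atTop, Filter.eventually_cofinite]
  exact Set.finite_image_iff (e.injective.injOn) |>.symm.trans
    (by rw [show e '' {x | ¬(a ∘ e) x = (b ∘ e) x} = {t | a t ≠ b t} by
      ext t; simp [Equiv.image_eq_preimage_symm]])

theorem measurableSet_setOf_eq {X Z : Type*} [MeasurableSpace X] [MeasurableSpace Z]
    [StandardBorelSpace Z] {u v : X → Z} (hu : Measurable u) (hv : Measurable v) :
    MeasurableSet {x | u x = v x} := by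
  obtain ⟨φ, hφ⟩ := MeasureTheory.exists_measurableEmbedding_real Z
  simpa only [Function.comp_apply, hφ.injective.eq_iff] using
    measurableSet_eq_fun (hφ.measurable.comp hu) (hφ.measurable.comp hv)

/-- The increasing union of the kernels of Borel maps with uniformly bounded fibers is Borel
reducible to eventual equality. -/
theorem exists_reduction_of_iUnion_ker {X : Type u} [MeasurableSpace X] [StandardBorelSpace X]
    (c : ℕ → X → X) (hc : ∀ n, Measurable (c n))
    (hd : ∀ n, ∃ d, SectionsCardLE d {p : X × X | c n p.2 = p.1})
    (hmono : ∀ n x y, c n x = c n y → c (n + 1) x = c (n + 1) y) :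
    ∃ g : X → (ℕ → Bool), Measurable g ∧
      ∀ x y, (∃ n, c n x = c n y) ↔ EventuallyEqual (g x) (g y) := by
  classical
  have hle : ∀ {m n x y}, m ≤ n → c m x = c m y → c n x = c n y := by
    intro m n x y hmn h
    induction n, hmn using Nat.le_induction with
    | base => exact h
    | succ n _ ih => exact hmono n x y ih
  have hlabel : ∀ n, ∃ l : X → ℕ, Measurable l ∧
      ∀ y z, c n y = c n z → l y = l z → y = z := by
    intro n
    obtain ⟨d, hd⟩ := hd n
    obtain ⟨l, hl, hinj⟩ := SectionsCardLE.exists_label d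
      (measurableSet_setOf_eq ((hc n).comp measurable_snd) measurable_fst) hd
    refine ⟨fun y => l (c n y, y), hl.comp ((hc n).prodMk measurable_id), fun y z hyz h => ?_⟩
    exact congrArg Prod.snd (hinj (c n y, y) rfl (c n z, z) rfl hyz h)
  choose l hl hlinj using hlabel
  obtain ⟨φ, hφ, hφinj⟩ := MeasurableSpace.measurable_injection_nat_bool_of_countablySeparated X
  let r : ℕ → X → ℕ × ℕ × ℕ × Bool := fun n z => (n, l n z, l (n + 1) z, φ z n.unpair.1)
  have hr : ∀ n, Measurable (r n) := by
    intro n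
    have h1 := hl n
    have h2 := hl (n + 1)
    have h3 : Measurable fun z => φ z n.unpair.1 := (measurable_pi_apply _).comp hφ
    fun_prop
  let S : X → Set (ℕ × ℕ × ℕ × Bool) := fun x => {t | ∃ z, c t.1 z = c t.1 x ∧ r t.1 z = t}
  have hS : ∀ t, MeasurableSet {x | t ∈ S x} := by
    intro t
    obtain ⟨d, hd⟩ := hd t.1
    have hP : MeasurableSet {p : X × X | c t.1 p.2 = c t.1 p.1 ∧ r t.1 p.2 = t} :=
      (measurableSet_setOf_eq ((hc _).comp measurable_snd) ((hc _).comp measurable_fst)).inter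
        (((hr t.1).comp measurable_snd) (measurableSet_singleton t))
    have hPd : SectionsCardLE d {p : X × X | c t.1 p.2 = c t.1 p.1 ∧ r t.1 p.2 = t} := by
      intro x
      obtain ⟨F, hF, hm⟩ := hd (c t.1 x)
      exact ⟨F, hF, fun y hy => hm y hy.1⟩
    convert hPd.measurableSet_image_fst hP using 1
    ext x
    simp [S]
  have hSfin : ∀ x m, {t | t ∈ S x ∧ t.1 < m}.Finite := by
    intro x m
    refine Set.Finite.subset (Set.Finite.biUnion (Set.finite_Iio m)
      (t := fun n => r n '' {z | c n z = c n x}) fun n _ => Set.Finite.image _ ?_) ?_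
    · obtain ⟨d, hd⟩ := hd n
      obtain ⟨F, -, hm⟩ := hd (c n x)
      exact F.finite_toSet.subset hm
    · rintro t ⟨⟨z, hz, hzt⟩, ht⟩
      exact Set.mem_biUnion (x := t.1) ht ⟨z, hz, hzt⟩
  obtain ⟨e⟩ := nonempty_equiv_of_countable (α := ℕ) (β := ℕ × ℕ × ℕ × Bool)
  refine ⟨fun x => (fun t => decide (t ∈ S x)) ∘ e, ?_, fun x y => ?_⟩
  · refine measurable_pi_lambda _ fun k => ?_
    refine measurable_to_bool ?_
    convert hS (e k) using 1
    ext x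
    simp
  rw [eventuallyEqual_comp_equiv_iff]
  constructor
  · rintro ⟨n, hn⟩
    refine ((hSfin x n).union (hSfin y n)).subset fun t ht => ?_
    have hlt : t.1 < n := by
      by_contra! h
      have hxy := hle h hn
      exact ht (by simp [S, hxy])
    by_cases hx : t ∈ S x
    · exact Or.inl ⟨hx, hlt⟩
    · refine Or.inr ⟨?_, hlt⟩
      by_contra hy
      exact ht (by simp [hx, hy])
  · intro hfin
    obtain ⟨m, hm⟩ := (hfin.image Prod.fst).bddAbove
    have key : ∀ n > m, ∀ z, c n z = c n x → ∃ w, c n w = c n y ∧ r n w = r n z := by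
      intro n hn z hz
      by_contra h
      have hx : r n z ∈ S x := ⟨z, hz, rfl⟩
      have hy : r n z ∉ S y := h
      have : n ≤ m := hm ⟨r n z, by simp [hx, hy], rfl⟩
      omega
    obtain ⟨w, hw, hrw⟩ := key (m + 1) (by omega) x rfl
    have hlw : ∀ n ≥ m + 1, l n w = l n x ∧ φ w n.unpair.1 = φ x n.unpair.1 := by
      have step : ∀ n ≥ m + 1, l n w = l n x → r n w = r n x := by
        intro n hn h
        obtain ⟨w', hw', hr'⟩ := key n hn x rfl
        have : w' = w := hlinj n _ _ (hw'.trans (hle hn hw).symm)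
          ((congrArg (fun t => t.2.1) hr').trans h.symm)
        rwa [this] at hr'
      have hl' : ∀ n ≥ m + 1, l n w = l n x := by
        intro n hn
        induction n, hn using Nat.le_induction with
        | base => exact congrArg (fun t => t.2.1) hrw
        | succ n hn ih => exact congrArg (fun t => t.2.2.1) (step n hn ih)
      exact fun n hn => ⟨hl' n hn, congrArg (fun t => t.2.2.2) (step n hn (hl' n hn))⟩
    have hwx : w = x := by
      refine hφinj (funext fun k => ?_)
      have := (hlw (Nat.pair k (m + 1)) (Nat.right_le_pair _ _)).2
      simpa using this
    exact ⟨m + 1, hwx ▸ hw⟩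

/-- Bounded Borel relations are closed under composition. -/
theorem SectionsCardLE.comp {X : Type*} {d d' : ℕ} {P Q : Set (X × X)} (hP : SectionsCardLE d P)
    (hQ : SectionsCardLE d' Q) :
    SectionsCardLE (d * d') {p : X × X | ∃ v, (p.1, v) ∈ P ∧ (v, p.2) ∈ Q} := by
  classical
  intro x
  obtain ⟨F, hF, hm⟩ := hP x
  choose F' hF' hm' using hQ
  refine ⟨F.biUnion F', (Finset.card_biUnion_le_card_mul _ _ _ fun v _ => hF' v).trans
    (Nat.mul_le_mul_right _ hF), ?_⟩
  rintro y ⟨v, hv, hvy⟩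
  exact Finset.mem_biUnion.2 ⟨v, hm v hv, hm' v y hvy⟩

theorem edist_le_add_one_iff {V : Type*} (G : SimpleGraph V) (k : ℕ) (x y : V) :
    G.edist x y ≤ (k + 1 : ℕ) ↔ ∃ v, G.edist x v ≤ k ∧ G.edist v y ≤ 1 := by
  constructor
  · intro h
    obtain ⟨p, hp⟩ := G.exists_walk_of_edist_ne_top (ne_top_of_le_ne_top (by simp) h)
    rw [← hp, Nat.cast_le] at h
    rcases Nat.lt_or_ge k p.length with hk | hk
    · refine ⟨p.getVert k, ?_, ?_⟩
      · refine (G.edist_le (p.take k)).trans ?_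
        simp [SimpleGraph.Walk.take_length]
      · refine (G.edist_le (p.drop k)).trans ?_
        have : (p.drop k).length ≤ 1 := by simp [SimpleGraph.Walk.drop_length]; omega
        exact_mod_cast this
    · exact ⟨y, hp ▸ Nat.cast_le.2 hk, by simp⟩
  · rintro ⟨v, hv, hvy⟩
    push_cast
    exact G.edist_triangle.trans (add_le_add hv hvy)

theorem edist_le_measurableSet_and_sectionsCardLE {X : Type u} [MeasurableSpace X]
    [StandardBorelSpace X] {G : SimpleGraph X} (hG : BorelGraph G) (hd : BddDegreeGraph G)
    (k : ℕ) : MeasurableSet {p : X × X | G.edist p.1 p.2 ≤ k} ∧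
      ∃ d, SectionsCardLE d {p : X × X | G.edist p.1 p.2 ≤ k} := by
  have hdiag : MeasurableSet {p : X × X | p.1 = p.2} :=
    measurableSet_setOf_eq measurable_fst measurable_snd
  have hone : MeasurableSet {p : X × X | G.edist p.1 p.2 ≤ 1} := by
    simp only [SimpleGraph.edist_le_one_iff_adj_or_eq]
    exact MeasurableSet.union hG hdiag
  obtain ⟨d₁, hd₁⟩ : ∃ d, SectionsCardLE d {p : X × X | G.edist p.1 p.2 ≤ 1} := by
    classical
    obtain ⟨d, hd⟩ := hd
    refine ⟨d + 1, fun x => ⟨insert x (hd x).1.toFinset, ?_, fun y hy => ?_⟩⟩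
    · refine (Finset.card_insert_le _ _).trans ?_
      rw [← Set.ncard_eq_toFinset_card _ (hd x).1]
      exact Nat.add_le_add_right (hd x).2 1
    · rcases SimpleGraph.edist_le_one_iff_adj_or_eq.1 hy with h | h
      · simp [show G.Adj x y from h]
      · simp [show x = y from h]
  induction k with
  | zero =>
    simp only [Nat.cast_zero, nonpos_iff_eq_zero, SimpleGraph.edist_eq_zero_iff]
    exact ⟨hdiag, 1, fun x => ⟨{x}, by simp, fun y hy => by simpa using Eq.symm hy⟩⟩
  | succ k ih =>
    obtain ⟨hk, d, hd⟩ := ih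
    simp only [edist_le_add_one_iff]
    refine ⟨?_, _, hd.comp hd₁⟩
    have hP : MeasurableSet {q : (X × X) × X | G.edist q.1.1 q.2 ≤ k ∧ G.edist q.2 q.1.2 ≤ 1} :=
      ((by fun_prop : Measurable fun q : (X × X) × X => (q.1.1, q.2)) hk).inter
        ((by fun_prop : Measurable fun q : (X × X) × X => (q.2, q.1.2)) hone)
    have hPd : SectionsCardLE d
        {q : (X × X) × X | G.edist q.1.1 q.2 ≤ k ∧ G.edist q.2 q.1.2 ≤ 1} := by
      intro p
      obtain ⟨F, hF, hm⟩ := hd p.1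
      exact ⟨F, hF, fun v hv => hm v hv.1⟩
    convert hPd.measurableSet_image_fst hP using 1
    ext p
    simp

/-- If `B` is sufficiently separated, there is a Borel map collapsing every `G`-ball of radius
`R` around a point of `B` to its center and fixing all other points. -/
theorem exists_collapse {X : Type u} [MeasurableSpace X] [StandardBorelSpace X]
    {G : SimpleGraph X} (hG : BorelGraph G) (hd : BddDegreeGraph G) {B : Set X}
    (hB : MeasurableSet B) {k R : ℕ} (hsep : SeparatedIn G k B) (hR : 2 * R ≤ k) :
    ∃ h : X → X, Measurable h ∧ (∀ x, G.edist x (h x) ≤ R) ∧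
      ∀ b ∈ B, ∀ x, G.edist x b ≤ R → h x = b := by
  classical
  have huniq : ∀ b ∈ B, ∀ b' ∈ B, ∀ x, G.edist x b ≤ R → G.edist x b' ≤ R → b = b' := by
    intro b hb b' hb' x h h'
    by_contra hne
    refine absurd (hsep b hb b' hb' hne) (not_lt.2 ?_)
    calc G.edist b b' ≤ G.edist b x + G.edist x b' := G.edist_triangle
      _ ≤ R + R := add_le_add (by rwa [SimpleGraph.edist_comm]) h'
      _ = (2 * R : ℕ) := by push_cast; ring
      _ ≤ k := Nat.cast_le.2 hR
  let h : X → X := fun x => if hx : ∃ b ∈ B, G.edist x b ≤ R then hx.choose else x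
  have hval : ∀ b ∈ B, ∀ x, G.edist x b ≤ R → h x = b := by
    intro b hb x hxb
    have hx : ∃ b ∈ B, G.edist x b ≤ R := ⟨b, hb, hxb⟩
    simp only [h, dif_pos hx]
    exact huniq _ hx.choose_spec.1 _ hb x hx.choose_spec.2 hxb
  obtain ⟨hmeas, d, hsec⟩ := edist_le_measurableSet_and_sectionsCardLE hG hd R
  have hproj : ∀ A : Set X, MeasurableSet A →
      MeasurableSet {x | ∃ b ∈ B ∩ A, G.edist x b ≤ R} := by
    intro A hA
    have hPd : SectionsCardLE d {p : X × X | p.2 ∈ B ∩ A ∧ G.edist p.1 p.2 ≤ R} := by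
      intro x
      obtain ⟨F, hF, hm⟩ := hsec x
      exact ⟨F, hF, fun y hy => hm y hy.2⟩
    convert hPd.measurableSet_image_fst ((measurable_snd (hB.inter hA)).inter hmeas) using 1
    ext x
    simp
  refine ⟨h, fun A hA => ?_, fun x => ?_, hval⟩
  · have : h ⁻¹' A = {x | ∃ b ∈ B ∩ A, G.edist x b ≤ R} ∪
        (A \ {x | ∃ b ∈ B ∩ univ, G.edist x b ≤ R}) := by
      ext x
      by_cases hx : ∃ b ∈ B, G.edist x b ≤ R
      · obtain ⟨b, hb, hxb⟩ := hx
        simp only [mem_preimage, hval b hb x hxb]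
        constructor
        · exact fun hbA => Or.inl ⟨b, ⟨hb, hbA⟩, hxb⟩
        · rintro (⟨b', hb', hxb'⟩ | ⟨-, hn⟩)
          · exact huniq b hb b' hb'.1 x hxb hxb' ▸ hb'.2
          · exact absurd ⟨b, ⟨hb, trivial⟩, hxb⟩ hn
      · have hhx : h x = x := dif_neg hx
        simp only [mem_preimage, hhx, mem_union, mem_sdiff, mem_ofPred_eq, inter_univ]
        constructor
        · exact fun hxA => Or.inr ⟨hxA, hx⟩
        · rintro (⟨b, hb, hxb⟩ | ⟨hxA, -⟩)
          · exact absurd ⟨b, hb.1, hxb⟩ hx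
          · exact hxA
    rw [this]
    exact (hproj A hA).union (hA.diff (hproj univ MeasurableSet.univ))
  · by_cases hx : ∃ b ∈ B, G.edist x b ≤ R
    · obtain ⟨b, hb, hxb⟩ := hx
      rwa [hval b hb x hxb]
    · have hhx : h x = x := dif_neg hx
      simp [hhx]

/-- Sufficiently separated covers yield hyperfiniteness. -/
theorem hyperfinite_of_separated_cover
    {X : Type*} [TopologicalSpace X] [PolishSpace X]
    [MeasurableSpace X] [BorelSpace X]
    (E : X → X → Prop) (hEquiv : Equivalence E)
    (hEBorel : MeasurableSet {p : X × X | E p.1 p.2})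
    (hEctble : ∀ x : X, {y : X | E x y}.Countable)
    (G : ℕ → SimpleGraph X)
    (hGBorel : ∀ n, BorelGraph (G n))
    (hGdeg : ∀ n, BddDegreeGraph (G n))
    (hGmono : ∀ n, G n ≤ G (n + 1))
    (hGunion : ∀ x y : X, (∃ n, (G n).Adj x y) ↔ (E x y ∧ x ≠ y))
    (f : ℕ → ℕ)
    (hf : ∀ n, f (n + 1) ≥ max (f n + 2) (2 * (f n + 1)))
    (B : ℕ → Set X)
    (hBmeas : ∀ n, MeasurableSet (B n))
    (hBsep : ∀ n, SeparatedIn (G n) (f n) (B n)) :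
    ∃ g : X → (ℕ → Bool), Measurable g ∧
      ∀ x ∈ {x : X | ∃ᶠ n in Filter.atTop, x ∈ B n},
        ∀ y ∈ {x : X | ∃ᶠ n in Filter.atTop, x ∈ B n},
          (E x y ↔ EventuallyEqual (g x) (g y)) := by
  classical
  have hfpow : ∀ n, 2 * 2 ^ n ≤ f (n + 1) := by
    intro n
    have key : 2 * 2 ^ n ≤ f (n + 1) ∧ 2 * 2 ^ n ≤ f n + 2 := by
      induction n with
      | zero => have := (le_max_left _ _).trans (hf 0); omega
      | succ n ih =>
        have := (le_max_right _ _).trans (hf n)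
        have := (le_max_right _ _).trans (hf (n + 1))
        rw [pow_succ]
        omega
    exact key.1
  choose h hhmeas hhdist hhval using fun n =>
    exists_collapse (hGBorel (n + 1)) (hGdeg (n + 1)) (hBmeas (n + 1)) (hBsep (n + 1)) (hfpow n)
  let c : ℕ → X → X := fun n => Nat.rec (h 0) (fun n u => h (n + 1) ∘ u) n
  have hcsucc : ∀ n x, c (n + 1) x = h (n + 1) (c n x) := fun _ _ => rfl
  have hcmeas : ∀ n, Measurable (c n) := by
    intro n
    induction n with
    | zero => exact hhmeas 0
    | succ n ih => exact (hhmeas (n + 1)).comp ih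
  have hcmono : ∀ n x y, c n x = c n y → c (n + 1) x = c (n + 1) y := by
    intro n x y hxy
    rw [hcsucc, hcsucc, hxy]
  have hcdist : ∀ n x, (G (n + 1)).edist x (c n x) ≤ (2 * 2 ^ n - 1 : ℕ) := by
    intro n x
    induction n with
    | zero => simpa [c] using hhdist 0 x
    | succ n ih =>
      calc (G (n + 2)).edist x (c (n + 1) x)
          ≤ (G (n + 2)).edist x (c n x) + (G (n + 2)).edist (c n x) (h (n + 1) (c n x)) :=
            SimpleGraph.edist_triangle
        _ ≤ (2 * 2 ^ n - 1 : ℕ) + (2 ^ (n + 1) : ℕ) :=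
            add_le_add ((SimpleGraph.edist_anti (hGmono (n + 1))).trans ih) (hhdist (n + 1) _)
        _ = (2 * 2 ^ (n + 1) - 1 : ℕ) := by
            rw [← Nat.cast_add, Nat.cast_inj]
            have := Nat.one_le_two_pow (n := n)
            rw [pow_succ]
            omega
  have hcfib : ∀ n, ∃ d, SectionsCardLE d {p : X × X | c n p.2 = p.1} := by
    intro n
    obtain ⟨-, d, hd⟩ := edist_le_measurableSet_and_sectionsCardLE (hGBorel (n + 1))
      (hGdeg (n + 1)) (2 * 2 ^ n - 1)
    refine ⟨d, fun x => ?_⟩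
    obtain ⟨F, hF, hm⟩ := hd x
    refine ⟨F, hF, fun y hy => hm y ?_⟩
    have hy : c n y = x := hy
    subst hy
    simpa [SimpleGraph.edist_comm] using hcdist n y
  have hcE : ∀ n x, E x (c n x) := by
    intro n x
    have hwalk : ∀ {u v : X}, (G (n + 1)).Walk u v → E u v := by
      intro u v p
      induction p with
      | nil => exact hEquiv.refl _
      | cons hadj _ ih => exact hEquiv.trans ((hGunion _ _).1 ⟨_, hadj⟩).1 ih
    obtain ⟨p⟩ := (G (n + 1)).reachable_of_edist_ne_top
      (ne_top_of_le_ne_top (ENat.natCast_ne_top _) (hcdist n x))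
    exact hwalk p
  have hcenter : ∀ n x y, x ∈ B (n + 2) → (G (n + 1)).edist y x ≤ 1 → c (n + 1) y = x := by
    intro n x y hx hyx
    refine hhval (n + 1) x hx (c n y) ?_
    calc (G (n + 2)).edist (c n y) x ≤ (G (n + 1)).edist (c n y) x :=
          SimpleGraph.edist_anti (hGmono (n + 1))
      _ ≤ (G (n + 1)).edist (c n y) y + (G (n + 1)).edist y x := SimpleGraph.edist_triangle
      _ ≤ (2 * 2 ^ n - 1 : ℕ) + (1 : ℕ) :=
          add_le_add (by rw [SimpleGraph.edist_comm]; exact hcdist n y) (by exact_mod_cast hyx)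
      _ = (2 ^ (n + 1) : ℕ) := by
          rw [← Nat.cast_add, Nat.cast_inj]
          have := Nat.one_le_two_pow (n := n)
          rw [pow_succ]
          omega
  obtain ⟨g, hg, hgred⟩ := exists_reduction_of_iUnion_ker c hcmeas hcfib hcmono
  refine ⟨g, hg, fun x hx y _ => ?_⟩
  rw [← hgred]
  constructor
  · intro hxy
    rcases eq_or_ne x y with rfl | hne
    · exact ⟨0, rfl⟩
    obtain ⟨k, hk⟩ := (hGunion x y).2 ⟨hxy, hne⟩
    obtain ⟨m, hm, hxm⟩ := Filter.frequently_atTop.1 hx (k + 2)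
    obtain ⟨n, rfl⟩ := Nat.exists_eq_add_of_le' (show 2 ≤ m by omega)
    have hadj : (G (n + 1)).Adj x y := monotone_nat_of_le_succ hGmono (show k ≤ n + 1 by omega) hk
    exact ⟨n + 1, (hcenter n x x hxm (by simp)).trans
      (hcenter n x y hxm (SimpleGraph.edist_le_one_iff_adj_or_eq.2 (Or.inl hadj.symm))).symm⟩
  · rintro ⟨n, hn⟩
    exact hEquiv.trans (hcE n x) (hn ▸ hEquiv.symm (hcE n y))
end

section
/- Let E be a countable Borel equivalence relation on a Polish space X. Then there exists a comeager E-invariant Borel set C ⊆ X such that the restriction of E to C is hyperfinite; explicitly, there is a Borel map g : X → 2^ℕ such that for all x, y ∈ C, x E y iff g(x) and g(y) are eventually equal. -/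
open Set MeasureTheory TopologicalSpace

/-- A set is `SigmaInjOn f` if it is covered by countably many measurable sets on each of which
`f` is injective. -/
def SigmaInjOn {X Z : Type*} [MeasurableSpace Z] (f : Z → X) (B : Set Z) : Prop :=
  ∃ s : ℕ → Set Z, (∀ n, MeasurableSet (s n) ∧ InjOn f (s n)) ∧ B ⊆ ⋃ n, s n

/-- The sets `U i` are negligible for `f` if every point of `X` can be assigned, in a measurable
way, an index `i` for which the fibre part lying in `U i` is `SigmaInjOn f`. -/
def NegligibleFamily {X Z ι : Type*} [MeasurableSpace X] [MeasurableSpace Z]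
    (f : Z → X) (U : ι → Set Z) : Prop :=
  ∃ A : ι → Set X, (∀ i, MeasurableSet (A i)) ∧ (∀ x, ∃ i, x ∈ A i) ∧
    ∀ i, SigmaInjOn f (U i ∩ f ⁻¹' A i)

section SigmaInjOn

variable {X Z : Type*} [MeasurableSpace Z] {f : Z → X}

theorem SigmaInjOn.mono {A B : Set Z} (hB : SigmaInjOn f B) (h : A ⊆ B) : SigmaInjOn f A := by
  obtain ⟨s, hs, hsB⟩ := hB
  exact ⟨s, hs, h.trans hsB⟩

theorem SigmaInjOn.iUnion {κ : Type*} [Countable κ] {B : κ → Set Z}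
    (h : ∀ k, SigmaInjOn f (B k)) : SigmaInjOn f (⋃ k, B k) := by
  choose s hs hB using h
  rcases isEmpty_or_nonempty κ with hκ | hκ
  · exact ⟨fun _ => ∅, by simp, by simp⟩
  obtain ⟨e, he⟩ := exists_surjective_nat (κ × ℕ)
  refine ⟨fun n => s (e n).1 (e n).2, fun n => hs _ _, iUnion_subset fun k z hz => ?_⟩
  obtain ⟨n, hn⟩ := mem_iUnion.1 (hB k hz)
  obtain ⟨m, hm⟩ := he (k, n)
  exact mem_iUnion.2 ⟨m, by simpa [hm] using hn⟩

theorem SigmaInjOn.of_injOn {B : Set Z} (hB : MeasurableSet B) (h : InjOn f B) :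
    SigmaInjOn f B :=
  ⟨fun _ => B, fun _ => ⟨hB, h⟩, subset_iUnion (fun _ : ℕ => B) 0⟩

theorem SigmaInjOn.union {A B : Set Z} (hA : SigmaInjOn f A) (hB : SigmaInjOn f B) :
    SigmaInjOn f (A ∪ B) := by
  rw [union_eq_iUnion]
  exact SigmaInjOn.iUnion fun b => by cases b <;> assumption

end SigmaInjOn

/-- Lusin separation for finitely many analytic sets: if no point of the measurable set `T`
lies in all the analytic sets `D i`, then `T` is covered by measurable sets `A i` disjoint
from the respective `D i`. -/
theorem exists_measurable_cover_of_analyticSet {X ι : Type*} [TopologicalSpace X] [PolishSpace X]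
    [MeasurableSpace X] [BorelSpace X] [DecidableEq ι] {D : ι → Set X}
    (hD : ∀ i, AnalyticSet (D i)) (s : Finset ι) {T : Set X} (hT : MeasurableSet T)
    (h : ∀ x ∈ T, ∃ i ∈ s, x ∉ D i) :
    ∃ A : ι → Set X, (∀ i, MeasurableSet (A i)) ∧ (∀ i, ∀ x ∈ A i, x ∉ D i) ∧
      ∀ x ∈ T, ∃ i ∈ s, x ∈ A i := by
  induction s using Finset.induction_on generalizing T with
  | empty => exact ⟨fun _ => ∅, by simp, by simp, fun x hx => by simpa using h x hx⟩
  | insert a s ha ih =>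
    have : Nonempty ι := ⟨a⟩
    have hu : AnalyticSet T := hT.analyticSet
    have hinter : ∀ {D' : ι → Set X}, (∀ i, AnalyticSet (D' i)) →
        AnalyticSet {x | x ∈ T ∧ ∀ i ∈ s, x ∈ D' i} := by
      intro D' hD'
      have : {x | x ∈ T ∧ ∀ i ∈ s, x ∈ D' i} =
          ⋂ o : Option s, (o.elim T fun i => D' i.1) := by
        ext x
        simp [Option.forall]
      rw [this]
      refine AnalyticSet.iInter fun o => ?_
      cases o with
      | none => exact hu
      | some i => exact hD' i
    have hDa : AnalyticSet (D a ∩ T) := by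
      rw [inter_eq_iInter]
      exact AnalyticSet.iInter fun b => by cases b; exacts [hu, hD a]
    obtain ⟨S, hS, hdisj, hSm⟩ := hDa.measurablySeparable (hinter hD) (by
      rw [Set.disjoint_left]
      rintro x ⟨hxa, hxT⟩ ⟨-, hx⟩
      obtain ⟨i, hi, hxi⟩ := h x hxT
      rcases Finset.mem_insert.1 hi with rfl | hi
      exacts [hxi hxa, hxi (hx i hi)])
    obtain ⟨A, hAm, hAD, hcov⟩ := ih (hT.inter hSm) (by
      rintro x ⟨hxT, hxS⟩
      by_contra! hx
      exact Set.disjoint_left.1 hdisj ⟨hxT, hx⟩ hxS)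
    refine ⟨Function.update A a (T \ S), fun i => ?_, fun i x hx => ?_, fun x hx => ?_⟩
    · by_cases hi : i = a
      · subst hi
        simpa using hT.diff hSm
      · simpa [hi] using hAm i
    · by_cases hi : i = a
      · subst hi
        rw [Function.update_self] at hx
        exact fun hxi => hx.2 (hS ⟨hxi, hx.1⟩)
      · rw [Function.update_of_ne hi] at hx
        exact hAD i x hx
    · by_cases hxS : x ∈ S
      · obtain ⟨i, hi, hxi⟩ := hcov x ⟨hx, hxS⟩
        refine ⟨i, Finset.mem_insert_of_mem hi, ?_⟩
        rwa [Function.update_of_ne (by rintro rfl; exact ha hi)]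
      · exact ⟨a, Finset.mem_insert_self _ _, by simpa using ⟨hx, hxS⟩⟩

section Splitting

variable {X Z ι : Type*} [TopologicalSpace X] [PolishSpace X] [MeasurableSpace X] [BorelSpace X]
  [Finite ι] {f : Z → X} {U : ι → Set Z}

theorem exists_common_image_of_not_negligible [MeasurableSpace Z] [StandardBorelSpace Z]
    (hf : Measurable f) (hU : ∀ i, MeasurableSet (U i)) (h : ¬ NegligibleFamily f U) :
    ∃ x, ∀ i, ∃ z ∈ U i, f z = x := by
  classical
  have := Fintype.ofFinite ι
  by_contra! hx
  obtain ⟨A, hAm, hA, hcov⟩ := exists_measurable_cover_of_analyticSet (D := fun i => f '' U i)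
    (fun i => (hU i).analyticSet_image hf) Finset.univ MeasurableSet.univ (by
      intro x _
      obtain ⟨i, hi⟩ := hx x
      exact ⟨i, Finset.mem_univ i, by rintro ⟨z, hz, rfl⟩; exact hi z hz rfl⟩)
  refine h ⟨A, hAm, fun x => by simpa using hcov x (mem_univ x), fun i => ?_⟩
  refine (SigmaInjOn.of_injOn MeasurableSet.empty (injOn_empty f)).mono ?_
  rintro z ⟨hz, hzA⟩
  exact (hA i _ hzA ⟨z, hz, rfl⟩).elim

theorem exists_split_of_not_negligible [MetricSpace Z] [PolishSpace Z] [MeasurableSpace Z]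
    [BorelSpace Z] (hf : Measurable f) (hU : ∀ i, MeasurableSet (U i))
    (h : ¬ NegligibleFamily f U) {ε : ℝ} (hε : 0 < ε) :
    ∃ V : ι × Bool → Set Z, (∀ j, MeasurableSet (V j)) ∧ (∀ j, V j ⊆ U j.1) ∧
      (∀ j, ∀ v ∈ V j, ∀ w ∈ V j, dist v w < ε) ∧
      (∀ i, Disjoint (closure (V (i, true))) (closure (V (i, false)))) ∧
      ¬ NegligibleFamily f V := by
  classical
  have := Fintype.ofFinite ι
  have := (countable_countableBasis Z).to_subtype
  by_contra! hV
  let Q : Set (ι × Bool → countableBasis Z) := {τ |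
    (∀ j, ∀ v ∈ (τ j : Set Z), ∀ w ∈ (τ j : Set Z), dist v w < ε) ∧
    ∀ i, Disjoint (closure (τ (i, true) : Set Z)) (closure (τ (i, false) : Set Z))}
  have hQ : ∀ τ : Q, NegligibleFamily f fun j => (τ.1 j : Set Z) ∩ U j.1 := fun τ =>
    hV _ (fun j => (isOpen_of_mem_countableBasis (τ.1 j).2).measurableSet.inter (hU _))
      (fun j => inter_subset_right) (fun j v hv w hw => τ.2.1 j v hv.1 w hw.1)
      (fun i => (τ.2.2 i).mono (closure_mono inter_subset_left) (closure_mono inter_subset_left))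
  choose A hAm hAcov hA using hQ
  obtain ⟨s, hs, hsub⟩ := SigmaInjOn.iUnion fun τ : Q => SigmaInjOn.iUnion (hA τ)
  have hNm : MeasurableSet (⋃ n, s n) := MeasurableSet.iUnion fun n => (hs n).1
  set N := ⋃ n, s n
  have hN : SigmaInjOn f N := ⟨s, hs, subset_rfl⟩
  have hUN : ∀ i, MeasurableSet (U i \ N) := fun i => (hU i).diff hNm
  obtain ⟨B, hBm, hB, hBcov⟩ := exists_measurable_cover_of_analyticSet
    (D := fun i => (fun p : Z × Z => f p.1) ''
      {p | p.1 ∈ U i \ N ∧ p.2 ∈ U i \ N ∧ f p.1 = f p.2 ∧ p.1 ≠ p.2})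
    (fun i => by
      refine MeasurableSet.analyticSet_image ?_ (hf.comp measurable_fst)
      refine (measurable_fst (hUN i)).inter ((measurable_snd (hUN i)).inter (.inter ?_ ?_))
      · exact measurableSet_eq_fun (hf.comp measurable_fst) (hf.comp measurable_snd)
      · exact (measurableSet_eq_fun measurable_fst measurable_snd).compl)
    Finset.univ MeasurableSet.univ (by
      intro x _
      by_contra! hx
      choose p hp hpx using fun i => hx i (Finset.mem_univ i)
      have hO : ∀ i, ∃ O : Bool → countableBasis Z,
          (p i).1 ∈ (O true : Set Z) ∧ (p i).2 ∈ (O false : Set Z) ∧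
          (∀ b, ∀ v ∈ (O b : Set Z), ∀ w ∈ (O b : Set Z), dist v w < ε) ∧
          Disjoint (closure (O true : Set Z)) (closure (O false : Set Z)) := by
        intro i
        obtain ⟨G, hG, hGo, H, hH, hHo, hGH⟩ := exists_open_nhds_disjoint_closure (hp i).2.2.2
        have key : ∀ z (G : Set Z), IsOpen G → z ∈ G → ∃ O ∈ countableBasis Z,
            z ∈ O ∧ O ⊆ G ∧ ∀ v ∈ O, ∀ w ∈ O, dist v w < ε := by
          intro z G hG hz
          obtain ⟨O, hO, hzO, hOsub⟩ := (isBasis_countableBasis Z).exists_subset_of_mem_open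
            (⟨hz, Metric.mem_ball_self (half_pos hε)⟩ : z ∈ G ∩ Metric.ball z (ε / 2))
            (hG.inter Metric.isOpen_ball)
          refine ⟨O, hO, hzO, fun v hv => (hOsub hv).1, fun v hv w hw => ?_⟩
          have h1 := Metric.mem_ball.1 (hOsub hv).2
          have h2 := Metric.mem_ball.1 (hOsub hw).2
          have h3 := dist_triangle_right v w z
          linarith
        obtain ⟨O, hO, h1, h2, h3⟩ := key _ _ hGo hG
        obtain ⟨O', hO', h1', h2', h3'⟩ := key _ _ hHo hH
        exact ⟨fun b => b.rec ⟨O', hO'⟩ ⟨O, hO⟩, h1, h1',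
          fun b => by cases b; exacts [h3', h3], hGH.mono (closure_mono h2) (closure_mono h2')⟩
      choose O hO1 hO2 hO3 hO4 using hO
      let τ : Q := ⟨fun j => O j.1 j.2, fun j => hO3 j.1 j.2, hO4⟩
      obtain ⟨⟨i, b⟩, hj⟩ := hAcov τ x
      have hmem : ∀ z, z ∈ (O i b : Set Z) → z ∈ U i → f z = x → z ∈ N := by
        rintro z hz hzU rfl
        exact hsub (mem_iUnion.2 ⟨τ, mem_iUnion.2 ⟨(i, b), ⟨hz, hzU⟩, hj⟩⟩)
      cases b with
      | true => exact (hp i).1.2 (hmem _ (hO1 i) (hp i).1.1 (hpx i))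
      | false => exact (hp i).2.1.2 (hmem _ (hO2 i) (hp i).2.1.1 ((hp i).2.2.1 ▸ hpx i)))
  refine h ⟨B, hBm, fun x => by simpa using hBcov x (mem_univ x), fun i => ?_⟩
  refine (hN.union (SigmaInjOn.of_injOn ((hUN i).inter (hf (hBm i))) ?_)).mono
    (B := N ∪ (U i \ N) ∩ f ⁻¹' B i) ?_
  · rintro v ⟨hv, hvB⟩ w ⟨hw, -⟩ hvw
    by_contra hne
    exact hB i _ hvB ⟨(v, w), ⟨hv, hw, hvw, hne⟩, rfl⟩
  · rintro z ⟨hz, hzB⟩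
    by_cases hzN : z ∈ N
    exacts [Or.inl hzN, Or.inr ⟨⟨hz, hzN⟩, hzB⟩]

end Splitting

section PerfectScheme

variable {X Z : Type*} [TopologicalSpace X] [PolishSpace X] [MeasurableSpace X] [BorelSpace X]
  {f : Z → X}

theorem exists_perfect_scheme [MetricSpace Z] [PolishSpace Z] [MeasurableSpace Z]
    [BorelSpace Z] (hf : Measurable f) (h : ¬ SigmaInjOn f univ) :
    ∃ U : ∀ n : ℕ, (Fin n → Bool) → Set Z,
      (∀ n i, U (n + 1) i ⊆ U n (Fin.init i)) ∧
      (∀ n i, ∀ v ∈ U (n + 1) i, ∀ w ∈ U (n + 1) i, dist v w < (1 / 2 : ℝ) ^ n) ∧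
      (∀ n (i j : Fin (n + 1) → Bool), Fin.init i = Fin.init j → i ≠ j →
        Disjoint (closure (U (n + 1) i)) (closure (U (n + 1) j))) ∧
      ∀ n, ∃ x, ∀ i, ∃ z ∈ U n i, f z = x := by
  let S : ℕ → Type _ := fun n => {U : (Fin n → Bool) → Set Z //
    (∀ i, MeasurableSet (U i)) ∧ ¬ NegligibleFamily f U}
  have step : ∀ n (U : S n), ∃ V : S (n + 1),
      (∀ i, V.1 i ⊆ U.1 (Fin.init i)) ∧
      (∀ i, ∀ v ∈ V.1 i, ∀ w ∈ V.1 i, dist v w < (1 / 2 : ℝ) ^ n) ∧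
      (∀ i j : Fin (n + 1) → Bool, Fin.init i = Fin.init j → i ≠ j →
        Disjoint (closure (V.1 i)) (closure (V.1 j))) := by
    rintro n ⟨U, hUm, hU⟩
    obtain ⟨V, hVm, hVU, hVd, hVdisj, hV⟩ :=
      exists_split_of_not_negligible hf hUm hU (ε := (1 / 2 : ℝ) ^ n) (by positivity)
    refine ⟨⟨fun i => V (Fin.init i, i (Fin.last n)), fun i => hVm _, ?_⟩, fun i => hVU _,
      fun i => hVd _, ?_⟩
    · rintro ⟨A, hAm, hAcov, hA⟩
      refine hV ⟨fun j => A (Fin.snoc (α := fun _ => Bool) j.1 j.2), fun j => hAm _,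
        fun x => ?_, fun j => ?_⟩
      · obtain ⟨i, hi⟩ := hAcov x
        exact ⟨(Fin.init i, i (Fin.last n)), by simpa using hi⟩
      · simpa using hA (Fin.snoc (α := fun _ => Bool) j.1 j.2)
    · intro i j hij hne
      have hlast : i (Fin.last n) ≠ j (Fin.last n) := by
        intro hl
        apply hne
        rw [← Fin.snoc_init_self i, ← Fin.snoc_init_self j, hij, hl]
      have hd := hVdisj (Fin.init j)
      dsimp only
      rw [hij]
      cases hi : i (Fin.last n) <;> cases hj : j (Fin.last n) <;> simp only [hi, hj] at hlast ⊢
      exacts [(hlast rfl).elim, hd.symm, hd, (hlast rfl).elim]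
  choose next hsub hdist hdisj using step
  have init : S 0 := ⟨fun _ => univ, fun _ => MeasurableSet.univ, by
    rintro ⟨A, -, hAcov, hA⟩
    refine h ((hA Fin.elim0).mono fun z _ => ⟨trivial, ?_⟩)
    obtain ⟨i, hi⟩ := hAcov (f z)
    rwa [Subsingleton.elim i Fin.elim0] at hi⟩
  let U : ∀ n, S n := fun n => Nat.rec init next n
  exact ⟨fun n => (U n).1, fun n => hsub n (U n), fun n => hdist n (U n),
    fun n => hdisj n (U n),
    fun n => exists_common_image_of_not_negligible hf (U n).2.1 (U n).2.2⟩

open Filter Topology in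
theorem sigmaInjOn_univ_of_countable_fibers [MetricSpace Z] [CompleteSpace Z] [PolishSpace Z]
    [MeasurableSpace Z] [BorelSpace Z] (hf : Continuous f)
    (hfib : ∀ x, (f ⁻¹' {x}).Countable) : SigmaInjOn f univ := by
  by_contra h
  obtain ⟨U, hsub, hdist, hdisj, hcommon⟩ := exists_perfect_scheme hf.measurable h
  choose x p hpU hpx using hcommon
  let r : (ℕ → Bool) → ∀ n : ℕ, Fin n → Bool := fun a n i => a i
  have hinit : ∀ a n, Fin.init (r a (n + 1)) = r a n := fun a n => rfl
  have hmono : ∀ a, Antitone fun n => U n (r a n) := fun a =>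
    antitone_nat_of_succ_le fun n => hsub n (r a (n + 1))
  have hcauchy : ∀ a, CauchySeq fun n => p (n + 1) (r a (n + 1)) := fun a =>
    cauchySeq_of_le_geometric (1 / 2) 1 (by norm_num) fun n => by
      rw [one_mul]
      exact (hdist n (r a (n + 1)) _ (hpU _ _) _
        (hmono a (Nat.le_succ (n + 1)) (hpU (n + 2) (r a (n + 2))))).le
  choose z hz using fun a => cauchySeq_tendsto_of_complete (hcauchy a)
  have hzU : ∀ a n, z a ∈ closure (U n (r a n)) := fun a n =>
    mem_closure_of_tendsto (hz a) (eventually_atTop.2 ⟨n, fun m hm =>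
      hmono a (show n ≤ m + 1 by lia) (hpU _ _)⟩)
  have hzinj : Function.Injective z := by
    intro a b hab
    by_contra hne
    have hex : ∃ n, a n ≠ b n := Function.ne_iff.1 hne
    classical
    have hn := Nat.find_spec hex
    set n := Nat.find hex
    have hlt : ∀ m < n, a m = b m := fun m hm => not_not.1 (Nat.find_min hex hm)
    refine Set.disjoint_left.1 (hdisj n (r a (n + 1)) (r b (n + 1)) ?_ ?_) (hzU a (n + 1))
      (hab ▸ hzU b (n + 1))
    · rw [hinit, hinit]
      exact funext fun i => hlt i i.2
    · exact fun he => hn (congrFun he (Fin.last n))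
  have hlim : ∀ a, Tendsto (fun n => x (n + 1)) atTop (𝓝 (f (z a))) := fun a => by
    have := (hf.tendsto (z a)).comp (hz a)
    simpa [Function.comp_def, hpx] using this
  have hc : (range z).Countable := (hfib (f (z fun _ => false))).mono (by
    rintro _ ⟨a, rfl⟩
    exact tendsto_nhds_unique (hlim a) (hlim _))
  have : Countable (ℕ → Bool) := by
    have := hc.to_subtype
    exact (rangeFactorization_injective.2 hzinj).countable
  obtain ⟨e, he⟩ := exists_surjective_nat (ℕ → Bool)
  obtain ⟨n, hn⟩ := he fun k => !e k k
  exact Bool.not_ne_self _ (congrFun hn n).symm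

/-- A measurable map with countable fibres between standard Borel spaces is injective on each of
countably many measurable sets covering its domain. -/
theorem sigmaInjOn_univ_of_measurable [MeasurableSpace Z] [StandardBorelSpace Z]
    (hf : Measurable f) (hfib : ∀ x, (f ⁻¹' {x}).Countable) : SigmaInjOn f univ := by
  obtain ⟨t, hb, hp⟩ := StandardBorelSpace.polish (α := Z)
  obtain ⟨t', ht', hcont, hp'⟩ := hf.exists_continuous
  have hb' : @BorelSpace Z t' _ :=
    ⟨hb.measurable_eq.trans (borel_eq_borel_of_le hp' hp ht').symm⟩
  let := t'
  let := upgradeIsCompletelyMetrizable Z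
  exact sigmaInjOn_univ_of_countable_fibers hcont hfib

end PerfectScheme

/-- **Luzin–Novikov** for equivalence relations: a countable Borel equivalence relation is the
union of the graphs of countably many Borel functions. -/
theorem exists_measurable_enumeration {X : Type*} [TopologicalSpace X] [PolishSpace X]
    [MeasurableSpace X] [BorelSpace X] {E : X → X → Prop} (hE : Equivalence E)
    (hEm : MeasurableSet {p : X × X | E p.1 p.2}) (hEc : ∀ x, {y | E x y}.Countable) :
    ∃ φ : ℕ → X → X, (∀ n, Measurable (φ n)) ∧ ∀ x y, E x y ↔ ∃ n, φ n x = y := by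
  classical
  let Z := {p : X × X // E p.1 p.2}
  have : StandardBorelSpace Z := hEm.standardBorel
  have hfst : Measurable fun z : Z => z.1.1 := measurable_fst.comp measurable_subtype_coe
  have hsnd : Measurable fun z : Z => z.1.2 := measurable_snd.comp measurable_subtype_coe
  obtain ⟨s, hs, hcov⟩ := sigmaInjOn_univ_of_measurable hfst fun x => by
    refine MapsTo.countable_of_injOn (f := fun z : Z => z.1.2) (t := {y | E x y}) ?_ ?_ (hEc x)
    · rintro ⟨⟨a, b⟩, hab⟩ rfl
      exact hab
    · rintro ⟨⟨a, b⟩, hab⟩ rfl ⟨⟨a', b'⟩, hab'⟩ h h'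
      simp_all
  let φ : ℕ → X → X := fun n x => if h : ∃ z ∈ s n, z.1.1 = x then h.choose.1.2 else x
  have hφ : ∀ n, ∀ z ∈ s n, φ n z.1.1 = z.1.2 := by
    intro n z hz
    have h : ∃ z' ∈ s n, z'.1.1 = z.1.1 := ⟨z, hz, rfl⟩
    simp only [φ, dif_pos h]
    rw [(hs n).2 h.choose_spec.1 hz h.choose_spec.2]
  refine ⟨φ, fun n B hB => ?_, fun x y => ⟨fun h => ?_, ?_⟩⟩
  · have : φ n ⁻¹' B = (fun z : Z => z.1.1) '' (s n ∩ (fun z : Z => z.1.2) ⁻¹' B) ∪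
        (((fun z : Z => z.1.1) '' s n)ᶜ ∩ B) := by
      ext x
      by_cases h : ∃ z ∈ s n, z.1.1 = x
      · obtain ⟨z, hz, rfl⟩ := h
        simp only [mem_preimage, hφ n z hz, mem_union, mem_image, mem_inter_iff, mem_compl_iff]
        refine ⟨fun h => Or.inl ⟨z, ⟨hz, h⟩, rfl⟩, ?_⟩
        rintro (⟨w, ⟨hw, hwB⟩, hwz⟩ | ⟨h, -⟩)
        · rwa [← (hs n).2 hw hz hwz]
        · exact (h ⟨z, hz, rfl⟩).elim
      · simp only [mem_preimage, φ, dif_neg h, mem_union, mem_image, mem_inter_iff, mem_compl_iff]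
        refine ⟨fun hx => Or.inr ⟨h, hx⟩, ?_⟩
        rintro (⟨w, ⟨hw, -⟩, hwz⟩ | ⟨-, hx⟩)
        exacts [(h ⟨w, hw, hwz⟩).elim, hx]
    rw [this]
    exact (((hs n).1.inter (hsnd hB)).image_of_measurable_injOn hfst
      ((hs n).2.mono inter_subset_left)).union
      ((((hs n).1.image_of_measurable_injOn hfst (hs n).2)).compl.inter hB)
  · obtain ⟨n, hn⟩ := mem_iUnion.1 (hcov (mem_univ (⟨(x, y), h⟩ : Z)))
    exact ⟨n, hφ n _ hn⟩
  · rintro ⟨n, rfl⟩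
    by_cases h : ∃ z ∈ s n, z.1.1 = x
    · obtain ⟨z, hz, rfl⟩ := h
      rw [hφ n z hz]
      exact z.2
    · simp only [φ, dif_neg h]
      exact hE.refl x

/-- A sequence of natural-number codes of the points of `X`, measurable, increasingly fine, and
jointly separating points. -/
structure IsSeparatingCode {X : Type*} [MeasurableSpace X] (d : ℕ → X → ℕ) : Prop where
  measurable : ∀ m, Measurable (d m)
  refine_le : ∀ m n x y, m ≤ n → d n x = d n y → d m x = d m y
  separates : ∀ x y, (∀ m, d m x = d m y) → x = y

theorem exists_isSeparatingCode (X : Type*) [MeasurableSpace X]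
    [MeasurableSpace.CountablySeparated X] : ∃ d : ℕ → X → ℕ, IsSeparatingCode d := by
  obtain ⟨c, hc, hinj⟩ := MeasurableSpace.measurable_injection_nat_bool_of_countablySeparated X
  refine ⟨fun m x => Encodable.encode fun i : Fin m => c x i, fun m => ?_, ?_, ?_⟩
  · have h : Measurable fun x => (fun i : Fin m => c x i) :=
      measurable_pi_lambda _ fun i => (measurable_pi_apply (i : ℕ)).comp hc
    exact (Measurable.of_discrete (f := Encodable.encode)).comp h
  · intro m n x y hmn h
    have h' := Encodable.encode_injective h
    exact congrArg _ (funext fun i => congrFun h' (Fin.castLE hmn i))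
  · intro x y h
    refine hinj (funext fun n => ?_)
    exact congrFun (Encodable.encode_injective (h (n + 1))) (Fin.last n)

open Filter in
theorem IsSeparatingCode.eventually_injOn {X : Type*} [MeasurableSpace X] {d : ℕ → X → ℕ}
    (hd : IsSeparatingCode d) {S : Set X} (hS : S.Finite) : ∀ᶠ m in atTop, InjOn (d m) S := by
  simp only [InjOn]
  refine (eventually_all_finite hS).2 fun x _ => (eventually_all_finite hS).2 fun y _ => ?_
  by_cases h : x = y
  · simp [h]
  · have : ∃ m, d m x ≠ d m y := by
      by_contra! hm
      exact h (hd.separates x y hm)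
    obtain ⟨m, hm⟩ := this
    exact eventually_atTop.2 ⟨m, fun n hn he => (hm (hd.refine_le m n x y hn he)).elim⟩

/-- `F` is a Borel equivalence relation with finite classes contained in `E`. -/
structure IsFiniteBorelSubrel {X : Type*} [MeasurableSpace X] (E F : X → X → Prop) : Prop where
  equivalence : Equivalence F
  le : ∀ x y, F x y → E x y
  finite : ∀ x, {y | F x y}.Finite
  measurableSet : MeasurableSet {p : X × X | F p.1 p.2}

theorem IsFiniteBorelSubrel.measurable_comp {X : Type*} [MeasurableSpace X]
    {E F : X → X → Prop} (hF : IsFiniteBorelSubrel E F) {g h : X → X} (hg : Measurable g)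
    (hh : Measurable h) : Measurable fun x => F (g x) (h x) :=
  measurableSet_setOfPred.1 ((hg.prodMk hh) hF.measurableSet)

/-- The section `{y | R x y}` of `R` is one and the same set for all `x` in it, and is invariant
under `F`. -/
def IsMergeable {X : Type*} (F R : X → X → Prop) (x : X) : Prop :=
  R x x ∧ ∀ y, R x y → ∀ z, (R y z ↔ R x z) ∧ (F y z → R x z)

/-- Enlarge `F` by merging the classes inside each mergeable section of `R`. -/
def mergeRel {X : Type*} (F R : X → X → Prop) (x y : X) : Prop :=
  F x y ∨ IsMergeable F R x ∧ R x y

section Merge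

variable {X : Type*} {E F R : X → X → Prop} {φ : ℕ → X → X}

theorem IsMergeable.of_rel {x y : X} (hx : IsMergeable F R x) (hxy : R x y) :
    IsMergeable F R y := by
  obtain ⟨hxx, hx⟩ := hx
  refine ⟨((hx y hxy y).1).2 hxy, fun z hyz w => ?_⟩
  have hxz : R x z := (hx y hxy z).1.1 hyz
  rw [(hx z hxz w).1, (hx y hxy w).1]
  exact ⟨Iff.rfl, (hx z hxz w).2⟩

theorem mergeRel_equivalence (hF : Equivalence F) : Equivalence (mergeRel F R) := by
  have key : ∀ x y, IsMergeable F R y → F y x → IsMergeable F R x ∧ R y x := fun x y hy hyx =>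
    have h := (hy.2 y hy.1 x).2 hyx
    ⟨hy.of_rel h, h⟩
  refine ⟨fun x => Or.inl (hF.refl x), ?_, ?_⟩
  · rintro x y (h | ⟨hx, h⟩)
    · exact Or.inl (hF.symm h)
    · exact Or.inr ⟨hx.of_rel h, ((hx.2 y h x).1).2 hx.1⟩
  · rintro x y z (hxy | ⟨hx, hxy⟩) (hyz | ⟨hy, hyz⟩)
    · exact Or.inl (hF.trans hxy hyz)
    · obtain ⟨hx, hyx⟩ := key x y hy (hF.symm hxy)
      exact Or.inr ⟨hx, ((hy.2 x hyx z).1).2 hyz⟩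
    · exact Or.inr ⟨hx, (hx.2 y hxy z).2 hyz⟩
    · exact Or.inr ⟨hx, (hx.2 y hxy z).1.1 hyz⟩

theorem measurableSet_isMergeable [MeasurableSpace X] (hφ : ∀ n, Measurable (φ n))
    (hEφ : ∀ x y, E x y ↔ ∃ n, φ n x = y) (hE : Equivalence E) (hF : IsFiniteBorelSubrel E F)
    (hRE : ∀ x y, R x y → E x y) (hR : MeasurableSet {p : X × X | R p.1 p.2}) :
    MeasurableSet {x | IsMergeable F R x} := by
  have hmeas : ∀ {g h : X → X}, Measurable g → Measurable h → Measurable fun x => R (g x) (h x) :=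
    fun hg hh => measurableSet_setOfPred.1 ((hg.prodMk hh) hR)
  have : {x | IsMergeable F R x} = {x | R x x ∧ ∀ i, R x (φ i x) → ∀ j,
      (R (φ i x) (φ j x) ↔ R x (φ j x)) ∧ (F (φ i x) (φ j x) → R x (φ j x))} := by
    ext x
    refine and_congr_right fun _ => ⟨fun h i hi j => h _ hi _, fun h y hy z => ?_⟩
    obtain ⟨i, rfl⟩ := (hEφ x y).1 (hRE _ _ hy)
    by_cases hz : E x z
    · obtain ⟨j, rfl⟩ := (hEφ x z).1 hz
      exact h i hy j
    · have h1 : ¬ R x z := fun h => hz (hRE _ _ h)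
      have h2 : ¬ R (φ i x) z := fun h => hz (hE.trans (hRE _ _ hy) (hRE _ _ h))
      have h3 : ¬ F (φ i x) z := fun h => hz (hE.trans (hRE _ _ hy) (hF.le _ _ h))
      simp [h1, h2, h3]
  rw [this, measurableSet_setOfPred]
  refine (hmeas measurable_id measurable_id).and (Measurable.forall fun i =>
    (hmeas measurable_id (hφ i)).imp (Measurable.forall fun j => .and (.iff ?_ ?_) (.imp ?_ ?_)))
  exacts [hmeas (hφ i) (hφ j), hmeas measurable_id (hφ j), hF.measurable_comp (hφ i) (hφ j),
    hmeas measurable_id (hφ j)]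

theorem isFiniteBorelSubrel_mergeRel [MeasurableSpace X] (hφ : ∀ n, Measurable (φ n))
    (hEφ : ∀ x y, E x y ↔ ∃ n, φ n x = y) (hE : Equivalence E) (hF : IsFiniteBorelSubrel E F)
    (hRE : ∀ x y, R x y → E x y) (hRfin : ∀ x, {y | R x y}.Finite)
    (hR : MeasurableSet {p : X × X | R p.1 p.2}) : IsFiniteBorelSubrel E (mergeRel F R) where
  equivalence := mergeRel_equivalence hF.equivalence
  le := by
    rintro x y (h | ⟨-, h⟩)
    exacts [hF.le _ _ h, hRE _ _ h]
  finite x := ((hF.finite x).union (hRfin x)).subset (by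
    rintro y (h | ⟨-, h⟩)
    exacts [Or.inl h, Or.inr h])
  measurableSet := hF.measurableSet.union
    ((measurable_fst (measurableSet_isMergeable hφ hEφ hE hF hRE hR)).inter hR)

end Merge

open Filter in
theorem mem_residual_of_forall_not_isMeagre {X : Type*} [TopologicalSpace X]
    [MeasurableSpace X] [BorelSpace X] {W : Set X} (hW : MeasurableSet W)
    (h : ∀ U, IsOpen U → U.Nonempty → ¬ IsMeagre (U ∩ W)) : W ∈ residual X := by
  obtain ⟨V, hV, hWV⟩ := hW.compl.residualEq_isOpen
  rcases V.eq_empty_or_nonempty with rfl | hne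
  · filter_upwards [hWV] with x hx
    by_contra hxW
    exact hx.mp hxW
  · refine (h V hV hne ?_).elim
    change (V ∩ W)ᶜ ∈ residual X
    filter_upwards [hWV] with x hx hxVW
    exact hx.mpr hxVW.1 hxVW.2

section Generic

variable {X : Type*} [TopologicalSpace X] [PolishSpace X] [MeasurableSpace X] [BorelSpace X]
  {E F : X → X → Prop} {φ : ℕ → X → X}

open Filter in
theorem exists_merge_not_isMeagre {d : ℕ → X → ℕ} (hd : IsSeparatingCode d)
    (hφ : ∀ n, Measurable (φ n)) (hEφ : ∀ x y, E x y ↔ ∃ n, φ n x = y) (hE : Equivalence E)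
    (hF : IsFiniteBorelSubrel E F) (k : ℕ) {U : Set X} (hU : IsOpen U) (hne : U.Nonempty) :
    ∃ F', IsFiniteBorelSubrel E F' ∧ (∀ x y, F x y → F' x y) ∧
      ¬ IsMeagre (U ∩ {x | F' x (φ k x)}) := by
  classical
  let R : ℕ × Finset (ℕ × ℕ) → X → X → Prop := fun p x y =>
    ∃ q ∈ p.2, d p.1 x = q.1 ∧ φ q.2 x = y
  have hRE : ∀ p x y, R p x y → E x y := by
    rintro p x y ⟨q, -, -, h⟩
    exact (hEφ x y).2 ⟨_, h⟩
  have hRfin : ∀ p x, {y | R p x y}.Finite := fun p x =>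
    (p.2.finite_toSet.image fun q => φ q.2 x).subset (by
      rintro y ⟨q, hq, -, h⟩
      exact ⟨q, hq, h⟩)
  have hRm : ∀ p, MeasurableSet {z : X × X | R p z.1 z.2} := by
    intro p
    have : {z : X × X | R p z.1 z.2} =
        ⋃ q ∈ p.2, {z : X × X | d p.1 z.1 = q.1} ∩ {z | φ q.2 z.1 = z.2} := by
      ext z
      simp [R]
    rw [this]
    exact p.2.measurableSet_biUnion fun q _ =>
      (((hd.measurable _).comp measurable_fst) (measurableSet_singleton q.1)).inter
        (measurableSet_eq_fun ((hφ _).comp measurable_fst) measurable_snd)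
  have hsec : ∀ x, ∀ S : Set X, S.Finite → (∀ y ∈ S, E x y) →
      ∃ p, ∀ y ∈ S, ∀ z, R p y z ↔ z ∈ S := by
    intro x S hS hSE
    obtain ⟨m, hm⟩ := (hd.eventually_injOn hS).exists
    have hk : ∀ y z, ∃ n, y ∈ S → z ∈ S → φ n y = z := by
      intro y z
      by_cases h : y ∈ S ∧ z ∈ S
      · obtain ⟨n, hn⟩ := (hEφ y z).1 (hE.trans (hE.symm (hSE y h.1)) (hSE z h.2))
        exact ⟨n, fun _ _ => hn⟩
      · exact ⟨0, fun h1 h2 => (h ⟨h1, h2⟩).elim⟩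
    choose κ hκ using hk
    refine ⟨(m, (hS.toFinset ×ˢ hS.toFinset).image fun q => (d m q.1, κ q.1 q.2)),
      fun y hy z => ⟨?_, fun hz => ?_⟩⟩
    · rintro ⟨q, hq, hq1, rfl⟩
      obtain ⟨⟨a, b⟩, hab, rfl⟩ := Finset.mem_image.1 hq
      simp only [Finset.mem_product, Finite.mem_toFinset] at hab
      obtain rfl := hm hy hab.1 hq1
      simpa only [hκ _ _ hy hab.2] using hab.2
    · refine ⟨(d m y, κ y z), Finset.mem_image.2 ⟨(y, z), ?_, rfl⟩, rfl, hκ y z hy hz⟩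
      simp [hy, hz]
  have hcov : ∀ x, ∃ p, mergeRel F (R p) x (φ k x) := by
    intro x
    have hxk : E x (φ k x) := (hEφ _ _).2 ⟨k, rfl⟩
    obtain ⟨p, hp⟩ := hsec x ({y | F x y} ∪ {y | F (φ k x) y})
      ((hF.finite _).union (hF.finite _)) (by
        rintro y (h | h)
        exacts [hF.le _ _ h, hE.trans hxk (hF.le _ _ h)])
    have hx : x ∈ {y | F x y} ∪ {y | F (φ k x) y} := Or.inl (hF.equivalence.refl x)
    have hkx : φ k x ∈ {y | F x y} ∪ {y | F (φ k x) y} := Or.inr (hF.equivalence.refl _)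
    refine ⟨p, Or.inr ⟨⟨(hp x hx x).2 hx, fun y hy z => ?_⟩, (hp x hx _).2 hkx⟩⟩
    have hy' := (hp x hx y).1 hy
    rw [hp x hx, hp y hy']
    refine ⟨Iff.rfl, fun hyz => ?_⟩
    rcases hy' with h | h
    exacts [Or.inl (hF.equivalence.trans h hyz), Or.inr (hF.equivalence.trans h hyz)]
  by_contra! hcon
  refine not_isMeagre_of_isOpen hU hne ((isMeagre_iUnion fun p =>
    hcon (mergeRel F (R p)) (isFiniteBorelSubrel_mergeRel hφ hEφ hE hF (hRE p) (hRfin p) (hRm p))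
      fun x y => Or.inl).mono fun x hx => ?_)
  obtain ⟨p, hp⟩ := hcov x
  exact mem_iUnion.2 ⟨p, hx, hp⟩

theorem exists_generic_exhaustion (hφ : ∀ n, Measurable (φ n))
    (hEφ : ∀ x y, E x y ↔ ∃ n, φ n x = y) (hE : Equivalence E) :
    ∃ F : ℕ → X → X → Prop, (∀ n, IsFiniteBorelSubrel E (F n)) ∧
      (∀ n x y, F n x y → F (n + 1) x y) ∧
      ∀ k, {x | ∃ n, F n x (φ k x)} ∈ residual X := by
  obtain ⟨d, hd⟩ := exists_isSeparatingCode X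
  obtain ⟨b, hb⟩ := ((countable_countableBasis X).insert ∅).exists_eq_range ⟨∅, by simp⟩
  have hbo : ∀ n, IsOpen (b n) := fun n => by
    have : b n ∈ insert ∅ (countableBasis X) := hb ▸ mem_range_self n
    rcases this with h | h
    · rw [h]; exact isOpen_empty
    · exact isOpen_of_mem_countableBasis h
  have step : ∀ (n : ℕ) (F : {F // IsFiniteBorelSubrel E F}),
      ∃ F' : {F // IsFiniteBorelSubrel E F}, (∀ x y, F.1 x y → F'.1 x y) ∧
        ((b n.unpair.2).Nonempty →
          ¬ IsMeagre (b n.unpair.2 ∩ {x | F'.1 x (φ n.unpair.1 x)})) := by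
    rintro n ⟨F, hF⟩
    by_cases hne : (b n.unpair.2).Nonempty
    · obtain ⟨F', hF', hle, hm⟩ :=
        exists_merge_not_isMeagre hd hφ hEφ hE hF n.unpair.1 (hbo _) hne
      exact ⟨⟨F', hF'⟩, hle, fun _ => hm⟩
    · exact ⟨⟨F, hF⟩, fun _ _ h => h, fun h => (hne h).elim⟩
  choose next hle hnext using step
  let F₀ : {F // IsFiniteBorelSubrel E F} := ⟨Eq, eq_equivalence, fun x y h => h ▸ hE.refl x,
    fun x => (finite_singleton x).subset fun y hy => Eq.symm hy,
    measurableSet_eq_fun measurable_fst measurable_snd⟩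
  let F : ℕ → {F // IsFiniteBorelSubrel E F} := fun n => Nat.rec F₀ next n
  refine ⟨fun n => (F n).1, fun n => (F n).2, fun n => hle n (F n), fun k => ?_⟩
  refine mem_residual_of_forall_not_isMeagre ?_ fun U hU hne hm => ?_
  · exact measurableSet_setOfPred.2
      (Measurable.exists fun n => (F n).2.measurable_comp measurable_id (hφ k))
  · obtain ⟨x, hx⟩ := hne
    obtain ⟨O, hO, hxO, hOU⟩ := (isBasis_countableBasis X).exists_subset_of_mem_open hx hU
    obtain ⟨i, rfl⟩ : O ∈ range b := hb ▸ mem_insert_of_mem _ hO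
    have h := hnext (Nat.pair k i) (F (Nat.pair k i))
    simp only [Nat.unpair_pair] at h
    refine h ⟨x, hxO⟩ (hm.mono ?_)
    rintro y ⟨hyO, hy⟩
    exact ⟨hOU hyO, Nat.pair k i + 1, hy⟩

end Generic

section Coding

variable {X : Type*} {F : ℕ → X → X → Prop} {d : ℕ → X → ℕ} {x y : X}

/-- The code `d m` is injective on the `F (n + 1)`-class of `x`, and `n ≤ m`. -/
def ResolvesClass (F : ℕ → X → X → Prop) (d : ℕ → X → ℕ) (n m : ℕ) (x : X) : Prop :=
  n ≤ m ∧ InjOn (d m) {y | F (n + 1) x y}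

/-- `m` is the least level at which `d` resolves the `F (n + 1)`-class of `x`, and `w` is the
level-`m` code of a point in the `F n`-class of `x`. -/
def ClassCode (F : ℕ → X → X → Prop) (d : ℕ → X → ℕ) (n m w : ℕ) (x : X) : Prop :=
  (ResolvesClass F d n m x ∧ ∀ m' < m, ¬ ResolvesClass F d n m' x) ∧ ∃ y, F n x y ∧ d m y = w

open Classical in
/-- The binary sequence listing all the class codes of `x`. -/
noncomputable def classCodeSeq (F : ℕ → X → X → Prop) (d : ℕ → X → ℕ) (x : X) (k : ℕ) : Bool :=
  decide (ClassCode F d k.unpair.1 k.unpair.2.unpair.1 k.unpair.2.unpair.2 x)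

theorem ClassCode.level_unique {n m m' w w' : ℕ} (h : ClassCode F d n m w x)
    (h' : ClassCode F d n m' w' x) : m = m' := by
  by_contra hne
  rcases lt_or_gt_of_ne hne with hlt | hlt
  exacts [h'.1.2 m hlt h.1.1, h.1.2 m' hlt h'.1.1]

theorem classCode_congr {n : ℕ} (hF : ∀ n, Equivalence (F n))
    (hmono : ∀ n x y, F n x y → F (n + 1) x y) (h : F n x y) (m w : ℕ) :
    ClassCode F d n m w x ↔ ClassCode F d n m w y := by
  have hrel : ∀ k, F k x y → ∀ z, F k x z ↔ F k y z := fun k hk z =>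
    ⟨(hF k).trans ((hF k).symm hk), (hF k).trans hk⟩
  simp only [ClassCode, ResolvesClass, hrel n h, hrel (n + 1) (hmono n x y h)]

theorem finite_classCode (hfin : ∀ n x, {y | F n x y}.Finite) (n : ℕ) (x : X) :
    {p : ℕ × ℕ | ClassCode F d n p.1 p.2 x}.Finite := by
  rcases {p : ℕ × ℕ | ClassCode F d n p.1 p.2 x}.eq_empty_or_nonempty with h | ⟨⟨m, w⟩, h⟩
  · simp [h]
  · refine ((hfin n x).image fun y => (m, d m y)).subset ?_
    rintro ⟨m', w'⟩ h'
    obtain rfl := h.level_unique h'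
    obtain ⟨y, hy, hw⟩ := h'.2
    exact ⟨y, hy, Prod.ext rfl hw⟩

variable [MeasurableSpace X] {E : X → X → Prop} {φ : ℕ → X → X}

theorem measurable_classCodeSeq (hφ : ∀ n, Measurable (φ n))
    (hEφ : ∀ x y, E x y ↔ ∃ n, φ n x = y) [MeasurableEq X]
    (hF : ∀ n, IsFiniteBorelSubrel E (F n)) (hd : IsSeparatingCode d) :
    Measurable (classCodeSeq F d) := by
  have hres : ∀ n m, Measurable fun x => ResolvesClass F d n m x := by
    intro n m
    have : (fun x => ResolvesClass F d n m x) = fun x => n ≤ m ∧ ∀ i, F (n + 1) x (φ i x) →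
        ∀ j, F (n + 1) x (φ j x) → d m (φ i x) = d m (φ j x) → φ i x = φ j x := by
      ext x
      refine and_congr_right fun _ => ⟨fun h i hi j hj => h hi hj, fun h y hy z hz => ?_⟩
      obtain ⟨i, rfl⟩ := (hEφ _ _).1 ((hF _).le _ _ hy)
      obtain ⟨j, rfl⟩ := (hEφ _ _).1 ((hF _).le _ _ hz)
      exact h i hy j hz
    rw [this]
    refine measurable_const.and (Measurable.forall fun i =>
      ((hF _).measurable_comp measurable_id (hφ i)).imp (Measurable.forall fun j =>
        ((hF _).measurable_comp measurable_id (hφ j)).imp (.imp ?_ ?_)))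
    · exact measurableSet_setOfPred.1 (measurableSet_eq_fun
        ((hd.measurable m).comp (hφ i)) ((hd.measurable m).comp (hφ j)))
    · exact measurableSet_setOfPred.1 (measurableSet_eq_fun (hφ i) (hφ j))
  have hcode : ∀ n m w, Measurable fun x => ClassCode F d n m w x := by
    intro n m w
    have : (fun x => ClassCode F d n m w x) = fun x =>
        (ResolvesClass F d n m x ∧ ∀ m', m' < m → ¬ ResolvesClass F d n m' x) ∧
          ∃ i, F n x (φ i x) ∧ d m (φ i x) = w := by
      ext x
      refine and_congr_right fun _ => ⟨?_, fun ⟨i, hi⟩ => ⟨_, hi⟩⟩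
      rintro ⟨y, hy, hw⟩
      obtain ⟨i, rfl⟩ := (hEφ _ _).1 ((hF _).le _ _ hy)
      exact ⟨i, hy, hw⟩
    rw [this]
    refine ((hres n m).and (Measurable.forall fun m' => measurable_const.imp (hres n m').not)).and
      (Measurable.exists fun i => ((hF _).measurable_comp measurable_id (hφ i)).and ?_)
    exact measurableSet_setOfPred.1
      (((hd.measurable m).comp (hφ i)) (measurableSet_singleton w))
  refine measurable_pi_lambda _ fun k => measurable_to_bool ?_
  have : (fun x => classCodeSeq F d x k) ⁻¹' {true} =
      {x | ClassCode F d k.unpair.1 k.unpair.2.unpair.1 k.unpair.2.unpair.2 x} := by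
    ext x
    simp [classCodeSeq]
  rw [this]
  exact measurableSet_setOfPred.2 (hcode _ _ _)

open Filter in
theorem exists_rel_iff_eventuallyEqual (hF : ∀ n, IsFiniteBorelSubrel E (F n))
    (hmono : ∀ n x y, F n x y → F (n + 1) x y) (hd : IsSeparatingCode d) (x y : X) :
    (∃ n, F n x y) ↔ EventuallyEqual (classCodeSeq F d x) (classCodeSeq F d y) := by
  classical
  have hEq := fun n => (hF n).equivalence
  have hle : ∀ x y, Monotone fun n => F n x y := fun x y =>
    monotone_nat_of_le_succ fun n => hmono n x y
  constructor
  · rintro ⟨N, hN⟩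
    rw [EventuallyEqual, ← Nat.cofinite_eq_atTop, eventually_cofinite]
    have hfin : ∀ z, (⋃ n ∈ Iio N, (fun p : ℕ × ℕ => Nat.pair n (Nat.pair p.1 p.2)) ''
        {p | ClassCode F d n p.1 p.2 z}).Finite := fun z =>
      (finite_Iio N).biUnion fun n _ => (finite_classCode (fun n => (hF n).finite) n z).image _
    refine ((hfin x).union (hfin y)).subset fun k hk => ?_
    have hlt : k.unpair.1 < N := by
      by_contra! hNk
      exact hk (decide_eq_decide.2 (classCode_congr hEq hmono (hle x y hNk hN) _ _))
    have hmem : ∀ z, ClassCode F d k.unpair.1 k.unpair.2.unpair.1 k.unpair.2.unpair.2 z →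
        k ∈ ⋃ n ∈ Iio N, (fun p : ℕ × ℕ => Nat.pair n (Nat.pair p.1 p.2)) ''
          {p | ClassCode F d n p.1 p.2 z} := fun z hz =>
      mem_biUnion (mem_Iio.2 hlt) ⟨k.unpair.2.unpair, hz, by simp⟩
    by_cases hx : ClassCode F d k.unpair.1 k.unpair.2.unpair.1 k.unpair.2.unpair.2 x
    · exact Or.inl (hmem x hx)
    · refine Or.inr (hmem y ?_)
      by_contra hy
      exact hk (decide_eq_decide.2 (iff_of_false hx hy))
  · intro h
    obtain ⟨N, hN⟩ := eventually_atTop.1 h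
    have hcode : ∀ n ≥ N, ∀ m w, ClassCode F d n m w x → ClassCode F d n m w y := by
      intro n hn m w hx
      have := decide_eq_decide.1 (hN (Nat.pair n (Nat.pair m w)) (hn.trans (Nat.left_le_pair _ _)))
      simp only [Nat.unpair_pair] at this
      exact this.1 hx
    have hlevel : ∀ n, ∃ m, ResolvesClass F d n m x ∧ ∀ m' < m, ¬ ResolvesClass F d n m' x := by
      intro n
      have hex : ∃ m, ResolvesClass F d n m x :=
        ((eventually_ge_atTop n).and (hd.eventually_injOn ((hF (n + 1)).finite x))).exists
      exact ⟨Nat.find hex, Nat.find_spec hex, fun m' => Nat.find_min hex⟩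
    choose m hm hmin using hlevel
    have hmm : ∀ n, m n ≤ m (n + 1) := by
      intro n
      by_contra! hlt
      exact hmin n _ hlt ⟨(Nat.le_succ n).trans (hm (n + 1)).1,
        (hm (n + 1)).2.mono fun z => hmono (n + 1) x z⟩
    have hy : ∀ n ≥ N, ClassCode F d n (m n) (d (m n) x) y := fun n hn =>
      hcode n hn _ _ ⟨⟨hm n, hmin n⟩, x, (hEq n).refl x, rfl⟩
    choose z hz hzd using fun n => fun hn => (hy n hn).2
    have hstep : ∀ n (hn : N ≤ n), z (n + 1) (hn.trans (Nat.le_succ n)) = z n hn := by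
      intro n hn
      refine (hy n hn).1.1.2 (hz _ _) (hmono n _ _ (hz n hn)) ?_
      rw [hzd n hn]
      exact hd.refine_le _ _ _ _ (hmm n) (hzd (n + 1) _)
    have hconst : ∀ n (hn : N ≤ n), z n hn = z N le_rfl := by
      intro n hn
      induction n, hn using Nat.le_induction with
      | base => rfl
      | succ n hn ih => exact (hstep n hn).trans ih
    have hzx : z N le_rfl = x := by
      refine hd.separates _ _ fun k => ?_
      have hk := hzd (max N k) (le_max_left _ _)
      rw [hconst] at hk
      exact hd.refine_le _ _ _ _ ((le_max_right N k).trans (hm (max N k)).1) hk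
    exact ⟨N, (hEq N).symm (hzx ▸ hz N le_rfl)⟩

end Coding

/-- Every countable Borel equivalence relation on a Polish space is hyperfinite on
a comeager invariant Borel set. -/
theorem cber_hyperfinite_on_comeager
    {X : Type*} [TopologicalSpace X] [PolishSpace X]
    [MeasurableSpace X] [BorelSpace X]
    (E : X → X → Prop) (hEquiv : Equivalence E)
    (hEBorel : MeasurableSet {p : X × X | E p.1 p.2})
    (hEctble : ∀ x : X, {y : X | E x y}.Countable) :
    ∃ C : Set X, MeasurableSet C ∧ C ∈ residual X ∧
      (∀ x y : X, x ∈ C → E x y → y ∈ C) ∧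
      ∃ g : X → (ℕ → Bool), Measurable g ∧
        ∀ x ∈ C, ∀ y ∈ C, (E x y ↔ EventuallyEqual (g x) (g y)) := by
  obtain ⟨φ, hφ, hEφ⟩ := exists_measurable_enumeration hEquiv hEBorel hEctble
  obtain ⟨F, hF, hmono, hgen⟩ := exists_generic_exhaustion hφ hEφ hEquiv
  obtain ⟨d, hd⟩ := exists_isSeparatingCode X
  have hle : ∀ x y, Monotone fun n => F n x y := fun x y =>
    monotone_nat_of_le_succ fun n => hmono n x y
  have hC : ∀ x ∈ {x | ∀ k, ∃ n, F n x (φ k x)}, ∀ y, E x y → ∃ n, F n x y := by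
    intro x hx y hxy
    obtain ⟨k, rfl⟩ := (hEφ x y).1 hxy
    exact hx k
  refine ⟨{x | ∀ k, ∃ n, F n x (φ k x)}, ?_, ?_, fun x y hx hxy k => ?_, classCodeSeq F d,
    measurable_classCodeSeq hφ hEφ hF hd, fun x hx y hy => ?_⟩
  · exact measurableSet_setOfPred.2 (Measurable.forall fun k => Measurable.exists fun n =>
      (hF n).measurable_comp measurable_id (hφ k))
  · rw [ofPred_forall]
    exact countable_iInter_mem.2 hgen
  · obtain ⟨n, hn⟩ := hC x hx y hxy
    obtain ⟨n', hn'⟩ := hC x hx (φ k y) (hEquiv.trans hxy ((hEφ _ _).2 ⟨k, rfl⟩))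
    exact ⟨max n n', (hF _).equivalence.trans
      ((hF _).equivalence.symm (hle x y (le_max_left n n') hn))
      (hle x _ (le_max_right n n') hn')⟩
  · rw [← exists_rel_iff_eventuallyEqual hF hmono hd]
    exact ⟨hC x hx y, fun ⟨n, hn⟩ => (hF n).le x y hn⟩
end

section
/- Let G be a bounded-degree Borel graph on the Ellentuck space [ℕ]^ℕ, let t ⊆ ℕ be a finite set and A ⊆ ℕ an infinite set with max t < min A. Then there exists an infinite set A' with t ⊆ A' ⊆ t ∪ A such that the cube [t, A' \ t] = {C infinite : t ⊆ C ⊆ A'} is G-independent, i.e., no two elements of this cube are G-adjacent. -/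
open Set MeasureTheory

/-- The basic Ellentuck set determined by a finite stem `t` and the elements of `A` above `t`. -/
def stemCube (t : Finset ℕ) (A : Set ℕ) : Set Ellentuck :=
  {C | ↑t ⊆ C.1 ∧ ∀ x ∈ C.1, x ∉ t → x ∈ A ∧ ∀ i ∈ t, i < x}

/-- `A` decides `R` at the stem `t`. -/
def DecidesCube (R : Set Ellentuck) (t : Finset ℕ) (A : Set ℕ) : Prop :=
  stemCube t A ⊆ R ∨ Disjoint (stemCube t A) R

/-- Completely Ramsey sets. -/
def CompletelyRamsey (R : Set Ellentuck) : Prop :=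
  ∀ (t : Finset ℕ) (A : Set ℕ), A.Infinite → ∃ B ⊆ A, B.Infinite ∧ DecidesCube R t B

theorem stemCube_subset {t : Finset ℕ} {A B : Set ℕ}
    (h : ∀ x ∈ B, (∀ i ∈ t, i < x) → x ∈ A) : stemCube t B ⊆ stemCube t A :=
  fun _ hC => ⟨hC.1, fun x hx hxt =>
    ⟨h x (hC.2 x hx hxt).1 (hC.2 x hx hxt).2, (hC.2 x hx hxt).2⟩⟩

theorem stemCube_mono {t : Finset ℕ} {A B : Set ℕ} (h : B ⊆ A) : stemCube t B ⊆ stemCube t A :=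
  stemCube_subset fun _ hx _ => h hx

theorem DecidesCube.mono {R : Set Ellentuck} {t : Finset ℕ} {A B : Set ℕ}
    (hA : DecidesCube R t A) (h : ∀ x ∈ B, (∀ i ∈ t, i < x) → x ∈ A) : DecidesCube R t B :=
  hA.imp (stemCube_subset h).trans fun hd => hd.mono_left (stemCube_subset h)

theorem exists_stem_of_mem_stemCube {t : Finset ℕ} {A : Set ℕ} {C : Ellentuck}
    (hC : C ∈ stemCube t A) (k : ℕ) :
    ∃ s : Finset ℕ, t ⊆ s ∧ C ∈ stemCube s A ∧ ∀ x ∈ C.1, x ≤ k → x ∈ s := by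
  classical
  refine ⟨t ∪ (Finset.range (k + 1)).filter (· ∈ C.1), Finset.subset_union_left, ⟨?_, ?_⟩, ?_⟩
  · intro x hx
    simp only [Finset.coe_union, Finset.coe_filter, Set.mem_union, Set.mem_ofPred_eq] at hx
    exact hx.elim (fun h => hC.1 h) (fun h => h.2)
  · intro x hx hxs
    simp only [Finset.mem_union, Finset.mem_filter, Finset.mem_range, not_or, not_and] at hxs
    refine ⟨(hC.2 x hx hxs.1).1, fun i hi => ?_⟩
    simp only [Finset.mem_union, Finset.mem_filter, Finset.mem_range] at hi
    have h1 : k < x := by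
      by_contra h
      exact hxs.2 (by omega) hx
    rcases hi with hi | hi
    · exact (hC.2 x hx hxs.1).2 i hi
    · omega
  · intro x hx hk
    simp only [Finset.mem_union, Finset.mem_filter, Finset.mem_range]
    exact Or.inr ⟨by omega, hx⟩

section Fusion

variable {Φ : Finset ℕ → Set ℕ → Prop}

theorem exists_forall_mem_finset
    (hered : ∀ s A B, Φ s A → (∀ x ∈ B, (∀ i ∈ s, i < x) → x ∈ A) → Φ s B)
    (dense : ∀ s A, A.Infinite → ∃ B ⊆ A, B.Infinite ∧ Φ s B)
    (F : Finset (Finset ℕ)) (A : Set ℕ) (hA : A.Infinite) :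
    ∃ B ⊆ A, B.Infinite ∧ ∀ s ∈ F, Φ s B := by
  classical
  induction F using Finset.induction_on with
  | empty => exact ⟨A, Subset.rfl, hA, by simp⟩
  | insert s F _ ih =>
    obtain ⟨B, hBA, hB, hF⟩ := ih
    obtain ⟨C, hCB, hC, hs⟩ := dense s B hB
    refine ⟨C, hCB.trans hBA, hC, fun u hu => ?_⟩
    rcases Finset.mem_insert.1 hu with rfl | hu
    · exact hs
    · exact hered u B C (hF u hu) fun x hx _ => hCB hx

theorem infinite_setOf_above {A : Set ℕ} (hA : A.Infinite) (t : Finset ℕ) :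
    {x ∈ A | ∀ i ∈ t, i < x}.Infinite := by
  refine Set.infinite_of_forall_exists_gt fun n => ?_
  obtain ⟨x, hx, hn⟩ := hA.exists_gt (max n (t.sup id))
  refine ⟨x, ⟨hx, fun i hi => ?_⟩, (le_max_left _ _).trans_lt hn⟩
  exact ((Finset.le_sup (f := id) hi).trans (le_max_right _ _)).trans_lt hn

/-- Diagonal intersection of a dense hereditary property of stems. -/
theorem exists_fusion
    (hered : ∀ s A B, Φ s A → (∀ x ∈ B, (∀ i ∈ s, i < x) → x ∈ A) → Φ s B)
    (dense : ∀ s A, A.Infinite → ∃ B ⊆ A, B.Infinite ∧ Φ s B)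
    (t : Finset ℕ) (A : Set ℕ) (hA : A.Infinite) :
    ∃ B ⊆ A, B.Infinite ∧ (∀ x ∈ B, ∀ i ∈ t, i < x) ∧
      ∀ s : Finset ℕ, t ⊆ s → ↑s ⊆ ↑t ∪ B → Φ s B := by
  classical
  obtain ⟨A₀, hA₀, hA₀inf, hΦ₀⟩ := dense t _ (infinite_setOf_above hA t)
  have step : ∀ C : Ellentuck, ∃ D : Ellentuck, D.1 ⊆ C.1 ∧ (∀ x ∈ D.1, sInf C.1 < x) ∧
      ∀ s ⊆ Finset.range (sInf C.1 + 1), Φ s D.1 := by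
    intro C
    obtain ⟨D, hD, hDinf, hs⟩ := exists_forall_mem_finset hered dense
      (Finset.range (sInf C.1 + 1)).powerset _ (infinite_setOf_above C.2 {sInf C.1})
    exact ⟨⟨D, hDinf⟩, fun x hx => (hD hx).1, fun x hx => (hD hx).2 _ (by simp),
      fun s h => hs s (Finset.mem_powerset.2 h)⟩
  choose next hsub hlt hnext using step
  let S : ℕ → Ellentuck := fun n => next^[n] ⟨A₀, hA₀inf⟩
  have hS : ∀ n, S (n + 1) = next (S n) := fun n => Function.iterate_succ_apply' _ _ _
  have hanti : Antitone fun n => (S n).1 := antitone_nat_of_succ_le fun n => by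
    simp only [hS]; exact hsub _
  let m : ℕ → ℕ := fun n => sInf (S n).1
  have hm : ∀ n, m n ∈ (S n).1 := fun n => Nat.sInf_mem (S n).2.nonempty
  have hmono : StrictMono m := strictMono_nat_of_lt_succ fun n => by
    have := hm (n + 1)
    rw [hS] at this
    exact hlt _ _ this
  have hmA : ∀ n, m n ∈ A₀ := fun n => hanti (Nat.zero_le n) (hm n)
  refine ⟨range m, ?_, infinite_range_of_injective hmono.injective, ?_, ?_⟩
  · rintro _ ⟨n, rfl⟩
    exact (hA₀ (hmA n)).1
  · rintro _ ⟨n, rfl⟩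
    exact (hA₀ (hmA n)).2
  · intro s hts hs
    by_cases hst : s ⊆ t
    · obtain rfl := Finset.Subset.antisymm hts hst
      refine hered _ _ _ hΦ₀ ?_
      rintro _ ⟨n, rfl⟩ _
      exact hmA n
    · obtain ⟨y, hy, hyt⟩ := Finset.not_subset.1 hst
      have hne : s.Nonempty := ⟨y, hy⟩
      have hmax : s.max' hne ∉ t := by
        intro h
        obtain ⟨n, rfl⟩ := (hs hy).resolve_left hyt
        have h1 := (hA₀ (hmA n)).2 _ h
        have h2 := s.le_max' _ hy
        omega
      obtain ⟨n, hn⟩ := (hs (s.max'_mem hne)).resolve_left hmax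
      have hΦ : Φ s (S (n + 1)).1 := by
        rw [hS]
        refine hnext _ _ fun x hx => ?_
        have := s.le_max' x hx
        rw [← hn] at this
        exact Finset.mem_range.2 (Nat.lt_succ_of_le this)
      refine hered _ _ _ hΦ ?_
      rintro _ ⟨j, rfl⟩ hj
      have := hj _ (s.max'_mem hne)
      rw [← hn] at this
      exact hanti (Nat.succ_le_of_lt (hmono.lt_iff_lt.1 this)) (hm j)

end Fusion

/-- No infinite subset of `A` puts its whole cube with stem `t` inside `R`. -/
def RejectsCube (R : Set Ellentuck) (t : Finset ℕ) (A : Set ℕ) : Prop :=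
  ∀ B ⊆ A, B.Infinite → ¬ stemCube t B ⊆ R

theorem RejectsCube.mono {R : Set Ellentuck} {t : Finset ℕ} {A B : Set ℕ}
    (hA : RejectsCube R t A) (h : ∀ x ∈ B, (∀ i ∈ t, i < x) → x ∈ A) : RejectsCube R t B := by
  intro C hC hCinf hCR
  refine hA {x ∈ C | ∀ i ∈ t, i < x} (fun x hx => h x (hC hx.1) hx.2)
    (infinite_setOf_above hCinf t) ((stemCube_mono ?_).trans hCR)
  exact fun x hx => hx.1

theorem exists_accepts_or_rejects (R : Set Ellentuck) (t : Finset ℕ) (A : Set ℕ)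
    (hA : A.Infinite) :
    ∃ B ⊆ A, B.Infinite ∧ (stemCube t B ⊆ R ∨ RejectsCube R t B) := by
  by_cases h : RejectsCube R t A
  · exact ⟨A, Subset.rfl, hA, Or.inr h⟩
  · simp only [RejectsCube, not_forall, not_not] at h
    obtain ⟨B, hBA, hB, hR⟩ := h
    exact ⟨B, hBA, hB, Or.inl hR⟩

theorem accepts_or_rejects_mono {R : Set Ellentuck} {t : Finset ℕ} {A B : Set ℕ}
    (hA : stemCube t A ⊆ R ∨ RejectsCube R t A) (h : ∀ x ∈ B, (∀ i ∈ t, i < x) → x ∈ A) :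
    stemCube t B ⊆ R ∨ RejectsCube R t B :=
  hA.imp (stemCube_subset h).trans fun hd => hd.mono h

theorem stemCube_subset_of_insert {R : Set Ellentuck} {t : Finset ℕ} {A : Set ℕ}
    (h : ∀ n ∈ A, (∀ i ∈ t, i < n) → stemCube (insert n t) A ⊆ R) : stemCube t A ⊆ R := by
  intro C hC
  have hne : (C.1 \ ↑t).Nonempty := (C.2.sdiff t.finite_toSet).nonempty
  have hmem := Nat.sInf_mem hne
  set n := sInf (C.1 \ ↑t) with hn
  obtain ⟨hnA, hnt⟩ := hC.2 n hmem.1 hmem.2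
  refine h n hnA hnt ⟨?_, fun x hx hxn => ?_⟩
  · rw [Finset.coe_insert]
    exact insert_subset hmem.1 hC.1
  · rw [Finset.mem_insert, not_or] at hxn
    obtain ⟨h1, h2⟩ := hC.2 x hx hxn.2
    refine ⟨h1, fun i hi => ?_⟩
    rcases Finset.mem_insert.1 hi with rfl | hi
    · exact lt_of_le_of_ne (Nat.sInf_le ⟨hx, hxn.2⟩) (Ne.symm hxn.1)
    · exact h2 i hi

theorem exists_accepts_or_rejects_insert (R : Set Ellentuck) (t : Finset ℕ) (A : Set ℕ)
    (hA : A.Infinite) :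
    ∃ B ⊆ A, B.Infinite ∧ (stemCube t B ⊆ R ∨ (RejectsCube R t B ∧
      ∀ n ∈ B, (∀ i ∈ t, i < n) → RejectsCube R (insert n t) B)) := by
  obtain ⟨B, hBA, hB, -, hdec⟩ := exists_fusion (Φ := fun s B =>
    stemCube s B ⊆ R ∨ RejectsCube R s B) (fun _ _ _ => accepts_or_rejects_mono)
    (exists_accepts_or_rejects R) t A hA
  rcases hdec t Finset.Subset.rfl subset_union_left with h | h
  · exact ⟨B, hBA, hB, Or.inl h⟩
  set D := {n ∈ B | stemCube (insert n t) B ⊆ R} with hD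
  have hDfin : D.Finite := by
    by_contra hinf
    refine h D (fun x hx => hx.1) hinf (stemCube_subset_of_insert fun n hn _ => ?_)
    exact (stemCube_mono fun x hx => hx.1).trans hn.2
  refine ⟨B \ D, sdiff_subset.trans hBA, hB.sdiff hDfin,
    Or.inr ⟨h.mono fun x hx _ => hx.1, fun n hn _ => ?_⟩⟩
  have hins := hdec (insert n t) (Finset.subset_insert _ _) (by
    rw [Finset.coe_insert]
    exact insert_subset (Or.inr hn.1) subset_union_left)
  rcases hins with h1 | h1
  · exact absurd ⟨hn.1, h1⟩ hn.2
  · exact h1.mono fun x hx _ => hx.1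

/-- Relatively Ellentuck-open sets can be decided. -/
theorem exists_decidesCube_of_open {R : Set Ellentuck} {t : Finset ℕ} {A : Set ℕ}
    (hA : A.Infinite)
    (hR : ∀ C ∈ stemCube t A, C ∈ R → ∃ s, t ⊆ s ∧ C ∈ stemCube s A ∧ stemCube s A ⊆ R) :
    ∃ B ⊆ A, B.Infinite ∧ DecidesCube R t B := by
  classical
  obtain ⟨B, hBA, hB, hBt, hdec⟩ := exists_fusion (Φ := fun s B =>
    stemCube s B ⊆ R ∨ (RejectsCube R s B ∧
      ∀ n ∈ B, (∀ i ∈ s, i < n) → RejectsCube R (insert n s) B))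
    (fun s A B hs h => hs.imp (stemCube_subset h).trans fun hd => ⟨hd.1.mono h, fun n hn hns =>
      (hd.2 n (h n hn hns) hns).mono fun x hx hxs =>
        h x hx fun i hi => hxs i (Finset.mem_insert_of_mem hi)⟩)
    (exists_accepts_or_rejects_insert R) t A hA
  refine ⟨B, hBA, hB, ?_⟩
  rcases hdec t Finset.Subset.rfl subset_union_left with h | h
  · exact Or.inl h
  right
  have key : ∀ u : Finset ℕ, ↑u ⊆ B → RejectsCube R (t ∪ u) B := by
    intro u
    induction u using Finset.induction_on_max with
    | empty => intro _; simpa using h.1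
    | insert a u hau ih =>
      intro hu
      rw [Finset.coe_insert, insert_subset_iff] at hu
      have hrej := ih hu.2
      rw [Finset.union_insert]
      rcases hdec (t ∪ u) Finset.subset_union_left (by
        rw [Finset.coe_union]; exact union_subset_union_right _ hu.2) with h1 | h1
      · exact absurd h1 (hrej B Subset.rfl hB)
      · refine h1.2 a hu.1 fun i hi => ?_
        rcases Finset.mem_union.1 hi with hi | hi
        · exact hBt a hu.1 i hi
        · exact hau i hi
  rw [Set.disjoint_left]
  intro C hC hCR
  obtain ⟨s, hts, hCs, hs⟩ := hR C (stemCube_mono hBA hC) hCR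
  have hsub : (↑(s \ t) : Set ℕ) ⊆ B := fun x hx => by
    rw [Finset.mem_coe, Finset.mem_sdiff] at hx
    exact (hC.2 x (hCs.1 hx.1) hx.2).1
  have := key _ hsub
  rw [Finset.union_sdiff_of_subset hts] at this
  exact this B Subset.rfl hB ((stemCube_mono hBA).trans hs)

theorem CompletelyRamsey.compl {R : Set Ellentuck} (hR : CompletelyRamsey R) :
    CompletelyRamsey Rᶜ := by
  intro t A hA
  obtain ⟨B, hBA, hB, h⟩ := hR t A hA
  refine ⟨B, hBA, hB, h.symm.imp (fun h => h.subset_compl_right) fun h => ?_⟩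
  exact disjoint_compl_right.mono_left h

theorem CompletelyRamsey.iUnion {R : ℕ → Set Ellentuck} (hR : ∀ n, CompletelyRamsey (R n)) :
    CompletelyRamsey (⋃ n, R n) := by
  intro t A hA
  obtain ⟨B, hBA, hB, -, hdec⟩ := exists_fusion
    (Φ := fun s B => ∀ n ≤ s.sup id, DecidesCube (R n) s B)
    (fun s A B hs h n hn => (hs n hn).mono h)
    (fun s A hA => by
      have : ∀ k, ∃ B ⊆ A, B.Infinite ∧ ∀ n < k, DecidesCube (R n) s B := by
        intro k
        induction k with
        | zero => exact ⟨A, Subset.rfl, hA, by simp⟩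
        | succ k ih =>
          obtain ⟨B, hBA, hB, h⟩ := ih
          obtain ⟨C, hCB, hC, h'⟩ := hR k s B hB
          refine ⟨C, hCB.trans hBA, hC, fun n hn => ?_⟩
          rcases Nat.lt_succ_iff_lt_or_eq.1 hn with hn | rfl
          · exact (h n hn).mono fun x hx _ => hCB hx
          · exact h'
      obtain ⟨B, hBA, hB, h⟩ := this (s.sup id + 1)
      exact ⟨B, hBA, hB, fun n hn => h n (Nat.lt_succ_of_le hn)⟩) t A hA
  obtain ⟨C, hCB, hC, h⟩ := exists_decidesCube_of_open (R := ⋃ n, R n) (t := t) hB (by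
    intro C hC hCR
    obtain ⟨n, hn⟩ := mem_iUnion.1 hCR
    obtain ⟨x, hx, hnx⟩ := C.2.exists_gt n
    obtain ⟨s, hts, hCs, hs⟩ := exists_stem_of_mem_stemCube hC x
    refine ⟨s, hts, hCs, ?_⟩
    have hle : n ≤ s.sup id := hnx.le.trans (Finset.le_sup (f := id) (hs x hx le_rfl))
    have hsB : (↑s : Set ℕ) ⊆ ↑t ∪ B := fun y hy => by
      by_cases hyt : y ∈ t
      · exact Or.inl hyt
      · exact Or.inr (hC.2 y (hCs.1 hy) hyt).1
    rcases hdec s hts hsB n hle with h | h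
    · exact h.trans (subset_iUnion R n)
    · exact absurd hn (Set.disjoint_left.1 h hCs))
  exact ⟨C, hCB.trans hBA, hC, h⟩

/-- The Galvin–Prikry theorem. -/
theorem MeasurableSet.completelyRamsey {R : Set Ellentuck} (hR : MeasurableSet R) :
    CompletelyRamsey R := by
  let M : MeasurableSpace Ellentuck :=
    { MeasurableSet' := CompletelyRamsey
      measurableSet_empty := fun t A hA => ⟨A, Subset.rfl, hA, Or.inr disjoint_bot_right⟩
      measurableSet_compl := fun _ => CompletelyRamsey.compl
      measurableSet_iUnion := fun _ => CompletelyRamsey.iUnion }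
  have hval : @Measurable _ _ M _ (Subtype.val : Ellentuck → Set ℕ) := by
    refine measurable_set_iff.2 fun a => measurableSet_setOfPred.1 ?_
    intro t A hA
    refine exists_decidesCube_of_open hA fun C hC hCa => ?_
    obtain ⟨s, hts, hCs, hs⟩ := exists_stem_of_mem_stemCube hC a
    exact ⟨s, hts, hCs, fun D hD => hD.1 (hs a hCa le_rfl)⟩
  obtain ⟨S, hS, rfl⟩ := hR
  exact hval hS

theorem measurableSet_image_fst_of_encard_le.{u} {Y : Type u} [MeasurableSpace Y]
    [StandardBorelSpace Y] (d : ℕ) :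
    ∀ {X : Type u} [MeasurableSpace X] [StandardBorelSpace X] {P : Set (X × Y)},
      MeasurableSet P → (∀ x, {y | (x, y) ∈ P}.encard ≤ d) → MeasurableSet (Prod.fst '' P) := by
  obtain ⟨f, hf⟩ := exists_measurableEmbedding_real Y
  induction d with
  | zero =>
    intro X _ _ P _ hd
    have : P = ∅ := by
      refine eq_empty_of_forall_notMem fun p hp => ?_
      have := hd p.1
      simp only [Nat.cast_zero, nonpos_iff_eq_zero, encard_eq_zero] at this
      exact (this ▸ hp : p.2 ∈ (∅ : Set Y))
    simp [this]
  | succ d ih =>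
    intro X _ _ P hP hd
    set T : Set ((X × Y) × Y) :=
      {q | q.1 ∈ P ∧ (q.1.1, q.2) ∈ P ∧ f q.2 < f q.1.2} with hT
    have hTm : MeasurableSet T := by
      refine (measurable_fst hP).inter (MeasurableSet.inter ?_ ?_)
      · exact (measurable_fst.fst.prodMk measurable_snd) hP
      · exact measurableSet_lt (hf.measurable.comp measurable_snd)
          (hf.measurable.comp measurable_fst.snd)
    have hTd : ∀ p : X × Y, {y | (p, y) ∈ T}.encard ≤ d := by
      rintro ⟨x, y⟩
      by_cases hp : (x, y) ∈ P
      · have hy : y ∉ {z | ((x, y), z) ∈ T} := fun h => lt_irrefl _ h.2.2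
        have hle : (insert y {z | ((x, y), z) ∈ T}).encard ≤ (d + 1 : ℕ) :=
          (encard_le_encard (insert_subset (show y ∈ {z | (x, z) ∈ P} from hp)
            fun z (hz : ((x, y), z) ∈ T) => hz.2.1)).trans (hd x)
        rw [encard_insert_of_notMem hy, Nat.cast_add, Nat.cast_one] at hle
        exact (ENat.add_le_add_iff_right ENat.one_ne_top).1 hle
      · have : {z | ((x, y), z) ∈ T} = ∅ :=
          eq_empty_of_forall_notMem fun z hz => hp hz.1
        simp [this]
    have himg := ih hTm hTd
    have heq : Prod.fst '' P = Prod.fst '' (P \ Prod.fst '' T) := by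
      refine Subset.antisymm ?_ (image_mono sdiff_subset)
      rintro _ ⟨⟨x, y⟩, hp, rfl⟩
      have hfin : {y | (x, y) ∈ P}.Finite := finite_of_encard_le_coe (hd x)
      obtain ⟨z, hz, hmin⟩ := exists_min_image _ f hfin ⟨y, hp⟩
      refine ⟨(x, z), ⟨hz, ?_⟩, rfl⟩
      rintro ⟨⟨_, w⟩, hw, rfl⟩
      exact (hmin w hw.2.1).not_gt hw.2.2
    rw [heq]
    refine (hP.diff himg).image_of_measurable_injOn measurable_fst ?_
    rintro ⟨x, y⟩ hy ⟨_, z⟩ hz rfl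
    have hyz : f y = f z := by
      refine le_antisymm (not_lt.1 fun h => hy.2 ⟨((x, y), z), ⟨hy.1, hz.1, h⟩, rfl⟩)
        (not_lt.1 fun h => hz.2 ⟨((x, z), y), ⟨hz.1, hy.1, h⟩, rfl⟩)
    rw [hf.injective hyz]

section Graph

variable {X : Type*} [MeasurableSpace X] [StandardBorelSpace X] {G : SimpleGraph X} {d : ℕ}

theorem BorelGraph.measurableSet_neighbors (hG : BorelGraph G)
    (hd : ∀ x, {y | G.Adj x y}.encard ≤ d) {B : Set X} (hB : MeasurableSet B) :
    MeasurableSet {x | ∃ y ∈ B, G.Adj x y} := by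
  have := measurableSet_image_fst_of_encard_le d
    (P := {p : X × X | G.Adj p.1 p.2} ∩ Prod.snd ⁻¹' B) (hG.inter (measurable_snd hB))
    (fun x => (encard_le_encard fun y hy => hy.1).trans (hd x))
  convert this using 1
  ext x
  simp [and_comm]

theorem exists_seq_measurableSet_separating (X : Type*) [MeasurableSpace X]
    [StandardBorelSpace X] :
    ∃ U : ℕ → Set X, (∀ n, MeasurableSet (U n)) ∧
      ∀ (F : Set X), F.Finite → ∀ x ∉ F, ∃ n, x ∈ U n ∧ Disjoint (U n) F := by
  let := upgradeStandardBorel X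
  obtain ⟨b, hbc, -, hb⟩ := TopologicalSpace.exists_countable_basis X
  rcases b.eq_empty_or_nonempty with rfl | hne
  · refine ⟨fun _ => ∅, fun _ => .empty, fun F hF x hx => ?_⟩
    obtain ⟨u, hu, -⟩ := hb.exists_subset_of_mem_open (mem_univ x) isOpen_univ
    exact absurd hu (notMem_empty u)
  obtain ⟨U, rfl⟩ := hbc.exists_eq_range hne
  refine ⟨U, fun n => (hb.isOpen ⟨n, rfl⟩).measurableSet, fun F hF x hx => ?_⟩
  obtain ⟨_, ⟨n, rfl⟩, hxn, hn⟩ :=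
    hb.exists_subset_of_mem_open (mem_compl hx) hF.isClosed.isOpen_compl
  exact ⟨n, hxn, disjoint_left.2 fun y hy => hn hy⟩

/-- Bounded-degree Borel graphs have Borel maximal independent sets. -/
theorem BorelGraph.exists_maximal_independent (hG : BorelGraph G)
    (hd : ∀ x, {y | G.Adj x y}.encard ≤ d) :
    ∃ M : Set X, MeasurableSet M ∧ (∀ x ∈ M, ∀ y ∈ M, ¬ G.Adj x y) ∧
      ∀ x ∉ M, ∃ y ∈ M, G.Adj x y := by
  obtain ⟨U, hU, hsep⟩ := exists_seq_measurableSet_separating X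
  let N : Set X → Set X := fun B => {x | ∃ y ∈ B, G.Adj x y}
  have hN : ∀ {B}, MeasurableSet B → MeasurableSet (N B) := hG.measurableSet_neighbors hd
  let I : ℕ → Set X := fun n => n.rec ∅ fun k S => S ∪ ((U k \ N (U k)) \ N S)
  have hI : ∀ n, I (n + 1) = I n ∪ ((U n \ N (U n)) \ N (I n)) := fun _ => rfl
  have hIm : ∀ n, MeasurableSet (I n) := by
    intro n
    induction n with
    | zero => exact .empty
    | succ n ih => exact ih.union (((hU n).diff (hN (hU n))).diff (hN ih))
  have hmono : Monotone I := monotone_nat_of_le_succ fun n => subset_union_left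
  have hind : ∀ n, ∀ x ∈ I n, ∀ y ∈ I n, ¬ G.Adj x y := by
    intro n
    induction n with
    | zero => exact fun x hx => absurd hx (notMem_empty x)
    | succ n ih =>
      intro x hx y hy hxy
      rw [hI] at hx hy
      rcases hx with hx | hx <;> rcases hy with hy | hy
      · exact ih x hx y hy hxy
      · exact hy.2 ⟨x, hx, hxy.symm⟩
      · exact hx.2 ⟨y, hy, hxy⟩
      · exact hx.1.2 ⟨y, hy.1.1, hxy⟩
  refine ⟨⋃ n, I n, .iUnion hIm, fun x hx y hy => ?_, fun x hx => ?_⟩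
  · obtain ⟨i, hi⟩ := mem_iUnion.1 hx
    obtain ⟨j, hj⟩ := mem_iUnion.1 hy
    exact hind (max i j) x (hmono (le_max_left _ _) hi) y (hmono (le_max_right _ _) hj)
  · obtain ⟨n, hxn, hn⟩ :=
      hsep {y | G.Adj x y} (finite_of_encard_le_coe (hd x)) x (G.loopless.irrefl x)
    have hxI : x ∉ I (n + 1) := fun h => hx (mem_iUnion.2 ⟨n + 1, h⟩)
    have hxN : x ∈ N (I n) := by
      by_contra h
      exact hxI (Or.inr ⟨⟨hxn, fun ⟨y, hy, hxy⟩ => disjoint_left.1 hn hy hxy⟩, h⟩)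
    obtain ⟨y, hy, hxy⟩ := hxN
    exact ⟨y, mem_iUnion.2 ⟨n, hy⟩, hxy⟩

end Graph

instance : StandardBorelSpace Ellentuck := by
  have : StandardBorelSpace (Set ℕ) := inferInstanceAs (StandardBorelSpace (ℕ → Prop))
  have : {A : Set ℕ | A.Infinite} = ⋂ n, ⋃ m, ⋃ _ : n < m, {A : Set ℕ | m ∈ A} := by
    ext A
    simp only [mem_ofPred_eq, mem_iInter, mem_iUnion, exists_prop]
    exact ⟨fun h n => (h.exists_gt n).imp fun m hm => hm.symm,
      fun h => infinite_of_forall_exists_gt fun n => (h n).imp fun m hm => hm.symm⟩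
  refine MeasurableSet.standardBorel (s := {A : Set ℕ | A.Infinite}) ?_
  rw [this]
  exact .iInter fun n => .iUnion fun m => .iUnion fun _ =>
    measurableSet_setOfPred.2 (measurable_set_mem m)

theorem BorelGraph.exists_independent_stemCube (d : ℕ) :
    ∀ {G : SimpleGraph Ellentuck}, BorelGraph G → (∀ x, {y | G.Adj x y}.encard ≤ d) →
      ∀ (t : Finset ℕ) (A : Set ℕ), A.Infinite → ∃ B ⊆ A, B.Infinite ∧
        ∀ C ∈ stemCube t B, ∀ D ∈ stemCube t B, ¬ G.Adj C D := by
  induction d with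
  | zero =>
    intro G _ hd t A hA
    refine ⟨A, Subset.rfl, hA, fun C _ D _ hCD => ?_⟩
    have := hd C
    simp only [Nat.cast_zero, nonpos_iff_eq_zero, encard_eq_zero] at this
    exact (this ▸ hCD : D ∈ (∅ : Set Ellentuck))
  | succ d ih =>
    intro G hG hd t A hA
    obtain ⟨M, hM, hind, hmax⟩ := hG.exists_maximal_independent hd
    obtain ⟨B, hBA, hB, hBM | hBM⟩ := hM.completelyRamsey t A hA
    · exact ⟨B, hBA, hB, fun C hC D hD => hind C (hBM hC) D (hBM hD)⟩
    let H : SimpleGraph Ellentuck :=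
      { Adj := fun x y => G.Adj x y ∧ x ∉ M ∧ y ∉ M
        symm := ⟨fun x y h => ⟨h.1.symm, h.2.2, h.2.1⟩⟩
        loopless := ⟨fun x h => G.loopless.irrefl x h.1⟩ }
    have hH : BorelGraph H :=
      hG.inter ((measurable_fst hM.compl).inter (measurable_snd hM.compl))
    have hHd : ∀ x, {y | H.Adj x y}.encard ≤ d := by
      intro x
      by_cases hx : x ∈ M
      · have : {y | H.Adj x y} = ∅ := eq_empty_of_forall_notMem fun y hy => hy.2.1 hx
        simp [this]
      · obtain ⟨z, hz, hxz⟩ := hmax x hx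
        have hz' : z ∉ {y | H.Adj x y} := fun h => h.2.2 hz
        have hle : (insert z {y | H.Adj x y}).encard ≤ (d + 1 : ℕ) :=
          (encard_le_encard (insert_subset hxz fun y hy => hy.1)).trans (hd x)
        rw [encard_insert_of_notMem hz', Nat.cast_add, Nat.cast_one] at hle
        exact (ENat.add_le_add_iff_right ENat.one_ne_top).1 hle
    obtain ⟨B', hB'B, hB', h⟩ := ih hH hHd t B hB
    refine ⟨B', hB'B.trans hBA, hB', fun C hC D hD hCD => h C hC D hD ⟨hCD, ?_, ?_⟩⟩
    · exact disjoint_left.1 hBM (stemCube_mono hB'B hC)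
    · exact disjoint_left.1 hBM (stemCube_mono hB'B hD)

/-- For a bounded degree Borel graph `G` on the Ellentuck space, any cube `[t, A]`
contains a subcube `[t, A' \ t]` that is `G`-independent. -/
theorem exists_independent_cube
    (G : SimpleGraph Ellentuck)
    (hGBorel : BorelGraph G) (hGdeg : BddDegreeGraph G)
    (t : Finset ℕ) (A : Set ℕ) (hA : A.Infinite)
    (htA : ∀ i ∈ t, ∀ j ∈ A, i < j) :
    ∃ A' : Set ℕ, A'.Infinite ∧ ↑t ⊆ A' ∧ A' ⊆ ↑t ∪ A ∧
      ∀ B C : Ellentuck, ↑t ⊆ B.1 → B.1 ⊆ A' → ↑t ⊆ C.1 → C.1 ⊆ A' →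
        ¬ G.Adj B C := by
  obtain ⟨d, hd⟩ := hGdeg
  obtain ⟨B, hBA, hB, h⟩ := hGBorel.exists_independent_stemCube d (fun x => by
    rw [← (hd x).1.cast_ncard_eq]
    exact_mod_cast (hd x).2) t A hA
  have hmem : ∀ C : Ellentuck, ↑t ⊆ C.1 → C.1 ⊆ ↑t ∪ B → C ∈ stemCube t B := by
    refine fun C htC hC => ⟨htC, fun x hx hxt => ?_⟩
    have hxB : x ∈ B := (hC hx).resolve_left hxt
    exact ⟨hxB, fun i hi => htA i hi x (hBA hxB)⟩
  exact ⟨↑t ∪ B, hB.mono subset_union_right, subset_union_left,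
    union_subset_union_right _ hBA, fun C D htC hC htD hD => h C (hmem C htC hC) D (hmem D htD hD)⟩
end
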